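/- Let μ ∈ ℝ be irrational. Then the spectrum of the critical almost Mathieu operator H_{μ,θ} is the same set for every θ ∈ ℝ, and, viewed as a subset of ℝ, it is a nonempty compact set which has no isolated points, has empty interior, and has Lebesgue measure zero (i.e., it is a Cantor set of Lebesgue measure zero). -/

import Mathlib

open Real MeasureTheory Filter

section HermitianMatrices

variable {n : Type*} [Fintype n] [DecidableEq n]

open Matrix

lemma Matrix.IsHermitian.inner_eigenvectorBasis_apply {A : Matrix n n ℂ} (hA : A.IsHermitian)
    (i : n) (x : EuclideanSpace ℂ n) :
    inner ℂ (hA.eigenvectorBasis i) (toLpLin 2 2 A x) =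
      hA.eigenvalues i * inner ℂ (hA.eigenvectorBasis i) x := by
  have hs := (isSymmetric_toEuclideanLin_iff.mpr hA) (hA.eigenvectorBasis i) x
  have he : toLpLin 2 2 A (hA.eigenvectorBasis i) =
      (hA.eigenvalues i : ℂ) • hA.eigenvectorBasis i := by
    ext j
    simpa [toLpLin_apply] using congrFun (hA.mulVec_eigenvectorBasis i) j
  rw [← hs, he, inner_smul_left]
  simp

lemma Matrix.IsHermitian.re_inner_apply_self {A : Matrix n n ℂ} (hA : A.IsHermitian)
    (x : EuclideanSpace ℂ n) :
    (inner ℂ x (toLpLin 2 2 A x)).re =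
      ∑ i, hA.eigenvalues i * ‖inner ℂ (hA.eigenvectorBasis i) x‖ ^ 2 := by
  rw [← hA.eigenvectorBasis.sum_inner_mul_inner, Complex.re_sum]
  refine Finset.sum_congr rfl fun i _ => ?_
  rw [hA.inner_eigenvectorBasis_apply, ← inner_conj_symm, ← mul_assoc,
    mul_comm (starRingEnd ℂ _), mul_assoc, Complex.conj_mul', ← Complex.ofReal_pow,
    Complex.re_ofReal_mul, Complex.ofReal_re]

/-- **Weyl's monotonicity principle**: ordered eigenvalues increase with the quadratic form. -/
theorem Matrix.IsHermitian.eigenvalues_mono {A C : Matrix n n ℂ} (hA : A.IsHermitian)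
    (hC : C.IsHermitian)
    (h : ∀ x : EuclideanSpace ℂ n,
      (inner ℂ x (toLpLin 2 2 A x)).re ≤ (inner ℂ x (toLpLin 2 2 C x)).re) (k : n) :
    hA.eigenvalues k ≤ hC.eigenvalues k := by
  set e := (Fintype.equivOfCardEq (Fintype.card_fin _) : Fin (Fintype.card n) ≃ n).symm
  let f : EuclideanSpace ℂ n →ₗ[ℂ] ({i : n // i ≠ k} → ℂ) := LinearMap.pi fun i =>
    if e k < e i then (innerSL ℂ (hA.eigenvectorBasis i)).toLinearMap
    else (innerSL ℂ (hC.eigenvectorBasis i)).toLinearMap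
  have hker : f.ker ≠ ⊥ := by
    apply LinearMap.ker_ne_bot_of_finrank_lt
    rw [Module.finrank_fintype_fun_eq_card, finrank_euclideanSpace]
    exact Fintype.card_subtype_lt (x := k) (by simp)
  obtain ⟨x, hx, hx0⟩ := Submodule.exists_mem_ne_zero_of_ne_bot hker
  have hfx : ∀ i : n, i ≠ k → (if e k < e i then inner ℂ (hA.eigenvectorBasis i) x
      else inner ℂ (hC.eigenvectorBasis i) x) = 0 := by
    intro i hi
    have := congrFun (LinearMap.mem_ker.mp hx) ⟨i, hi⟩
    simp only [f, LinearMap.pi_apply, Pi.zero_apply] at this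
    split_ifs with hlt
    · simpa [hlt] using this
    · simpa [hlt] using this
  have hlow : hA.eigenvalues k * ‖x‖ ^ 2 ≤ (inner ℂ x (toLpLin 2 2 A x)).re := by
    rw [hA.re_inner_apply_self, ← hA.eigenvectorBasis.sum_sq_norm_inner_right x, Finset.mul_sum]
    refine Finset.sum_le_sum fun i _ => ?_
    by_cases hlt : e k < e i
    · have hi := hfx i (by rintro rfl; exact lt_irrefl _ hlt)
      rw [if_pos hlt] at hi
      simp [hi]
    · exact mul_le_mul_of_nonneg_right (hA.eigenvalues₀_antitone (not_lt.mp hlt)) (by positivity)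
  have hup : (inner ℂ x (toLpLin 2 2 C x)).re ≤ hC.eigenvalues k * ‖x‖ ^ 2 := by
    rw [hC.re_inner_apply_self, ← hC.eigenvectorBasis.sum_sq_norm_inner_right x, Finset.mul_sum]
    refine Finset.sum_le_sum fun i _ => ?_
    by_cases hlt : e i < e k
    · have hi := hfx i (by rintro rfl; exact lt_irrefl _ hlt)
      rw [if_neg hlt.not_gt] at hi
      simp [hi]
    · exact mul_le_mul_of_nonneg_right (hC.eigenvalues₀_antitone (not_lt.mp hlt)) (by positivity)
  have hpos : 0 < ‖x‖ ^ 2 := by positivity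
  exact le_of_mul_le_mul_right (hlow.trans ((h x).trans hup)) hpos

/-- The ordered eigenvalues of two Hermitian matrices with a common upper bound `C` are
close in `ℓ¹`, in terms of traces. -/
theorem Matrix.IsHermitian.sum_abs_eigenvalues_sub_le {A B C : Matrix n n ℂ}
    (hA : A.IsHermitian) (hB : B.IsHermitian) (hC : C.IsHermitian)
    (hAC : ∀ x : EuclideanSpace ℂ n,
      (inner ℂ x (toLpLin 2 2 A x)).re ≤ (inner ℂ x (toLpLin 2 2 C x)).re)
    (hBC : ∀ x : EuclideanSpace ℂ n,
      (inner ℂ x (toLpLin 2 2 B x)).re ≤ (inner ℂ x (toLpLin 2 2 C x)).re) :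
    ∑ i, |hA.eigenvalues i - hB.eigenvalues i| ≤
      2 * C.trace.re - A.trace.re - B.trace.re := by
  rw [hA.trace_eq_sum_eigenvalues, hB.trace_eq_sum_eigenvalues, hC.trace_eq_sum_eigenvalues]
  simp only [Complex.coe_algebraMap, Complex.re_sum, Complex.ofReal_re]
  rw [Finset.mul_sum, ← Finset.sum_sub_distrib, ← Finset.sum_sub_distrib]
  refine Finset.sum_le_sum fun i _ => ?_
  have h1 := hA.eigenvalues_mono hC hAC i
  have h2 := hB.eigenvalues_mono hC hBC i
  rw [abs_le]
  constructor <;> linarith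

/-- An approximate eigenvector forces a nearby eigenvalue. -/
theorem Matrix.IsHermitian.exists_abs_eigenvalues_sub_le {A : Matrix n n ℂ}
    (hA : A.IsHermitian) {E η : ℝ} (hη : 0 ≤ η) {v : n → ℂ} (hv : 0 < ∑ i, ‖v i‖ ^ 2)
    (h : ∑ i, ‖(A *ᵥ v) i - E * v i‖ ^ 2 ≤ η ^ 2 * ∑ i, ‖v i‖ ^ 2) :
    ∃ i, |hA.eigenvalues i - E| ≤ η := by
  by_contra! hcon
  set x : EuclideanSpace ℂ n := WithLp.toLp 2 v
  have hx : ‖x‖ ^ 2 = ∑ i, ‖v i‖ ^ 2 := by simp [EuclideanSpace.norm_sq_eq, x]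
  have hy : ‖toLpLin 2 2 A x - (E : ℂ) • x‖ ^ 2 = ∑ i, ‖(A *ᵥ v) i - E * v i‖ ^ 2 := by
    simp [EuclideanSpace.norm_sq_eq, x, toLpLin_apply]
  rw [← hx, ← hy, ← hA.eigenvectorBasis.sum_sq_norm_inner_right x,
    ← hA.eigenvectorBasis.sum_sq_norm_inner_right, Finset.mul_sum] at h
  rw [← hx, ← hA.eigenvectorBasis.sum_sq_norm_inner_right x] at hv
  obtain ⟨j, -, hj⟩ := Finset.exists_ne_zero_of_sum_ne_zero hv.ne'
  refine h.not_gt (Finset.sum_lt_sum (fun i _ => ?_) ⟨j, Finset.mem_univ _, ?_⟩)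
  all_goals
    rw [inner_sub_right, hA.inner_eigenvectorBasis_apply, inner_smul_right, ← sub_mul, norm_mul,
      mul_pow, ← Complex.ofReal_sub, Complex.norm_real, Real.norm_eq_abs]
  · gcongr
    exact (hcon i).le
  · refine mul_lt_mul_of_pos_right ?_ (lt_of_le_of_ne (by positivity) hj.symm)
    exact pow_lt_pow_left₀ (hcon j) hη two_ne_zero

end HermitianMatrices

/-- If `∏ (x - a i)` and `∏ (x - b i)` lie on different sides of zero, then `x` lies between some
`a i` and `b i`. -/
lemma exists_mem_uIcc_of_prod_mul_prod_nonpos {ι : Type*} [Fintype ι] {a b : ι → ℝ} {x : ℝ}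
    (h : (∏ i, (x - a i)) * ∏ i, (x - b i) ≤ 0) : ∃ i, x ∈ Set.uIcc (a i) (b i) := by
  by_contra! hcon
  rw [← Finset.prod_mul_distrib] at h
  refine h.not_gt (Finset.prod_pos fun i _ => ?_)
  have hi := hcon i
  rw [Set.mem_uIcc] at hi
  push Not at hi
  rcases lt_or_ge x (a i) with h | h
  · have : x < b i := by
      by_contra! h'
      exact absurd (hi.2 h') (by linarith)
    nlinarith
  · have hb : b i < x := hi.1 h
    have ha : a i < x := by
      by_contra! h'
      exact absurd (hi.2 hb.le) (by linarith)
    nlinarith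

section LaurentAverages

/-- `g` is a Laurent polynomial with exponents in `[-d, u]`. -/
def IsLaurentOn (d u : ℕ) (g : ℂ → ℂ) : Prop :=
  ∃ p : Polynomial ℂ, p.natDegree ≤ d + u ∧ ∀ z : ℂ, z ≠ 0 → g z = z⁻¹ ^ d * p.eval z

lemma IsLaurentOn.const (a : ℂ) : IsLaurentOn 0 0 fun _ => a :=
  ⟨Polynomial.C a, by simp, fun z _ => by simp⟩

lemma IsLaurentOn.mul {d u d' u' : ℕ} {g g' : ℂ → ℂ} (h : IsLaurentOn d u g)
    (h' : IsLaurentOn d' u' g') : IsLaurentOn (d + d') (u + u') fun z => g z * g' z := by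
  obtain ⟨p, hp, hg⟩ := h
  obtain ⟨p', hp', hg'⟩ := h'
  refine ⟨p * p', Polynomial.natDegree_mul_le.trans (by lia), fun z hz => ?_⟩
  simp only [hg z hz, hg' z hz, Polynomial.eval_mul]
  ring

lemma IsLaurentOn.prod {ι : Type*} (s : Finset ι) {d u : ι → ℕ} {g : ι → ℂ → ℂ}
    (h : ∀ i, IsLaurentOn (d i) (u i) (g i)) :
    IsLaurentOn (∑ i ∈ s, d i) (∑ i ∈ s, u i) fun z => ∏ i ∈ s, g i z := by
  classical
  induction s using Finset.induction_on with
  | empty => simpa using IsLaurentOn.const 1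
  | insert i s hi ih =>
    simp only [Finset.sum_insert hi, Finset.prod_insert hi]
    exact (h i).mul ih

lemma IsLaurentOn.sum {ι : Type*} (s : Finset ι) {d u : ℕ} {g : ι → ℂ → ℂ}
    (h : ∀ i, IsLaurentOn d u (g i)) : IsLaurentOn d u fun z => ∑ i ∈ s, g i z := by
  choose p hp hg using h
  refine ⟨∑ i ∈ s, p i, Polynomial.natDegree_sum_le_of_forall_le _ _ fun i _ => hp i,
    fun z hz => ?_⟩
  rw [Polynomial.eval_finsetSum, Finset.mul_sum]
  exact Finset.sum_congr rfl fun i _ => hg i z hz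

/-- Averaging a Laurent polynomial with exponents in `(-q, q)` over `q`-th roots of unity leaves
only its constant term. -/
lemma IsLaurentOn.exists_sum_stdAddChar {q : ℕ} [NeZero q] {d u : ℕ} {g : ℂ → ℂ}
    (h : IsLaurentOn d u g) (hd : d < q) (hu : u < q) {a : ZMod q} (ha : IsUnit a) :
    ∃ C : ℂ, ∀ z : ℂ, z ≠ 0 → ∑ k : ZMod q, g (ZMod.stdAddChar (a * k) * z) = C := by
  obtain ⟨p, hp, hg⟩ := h
  refine ⟨q * p.coeff d, fun z hz => ?_⟩
  have hne : ∀ k : ZMod q, ZMod.stdAddChar k ≠ 0 := fun k =>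
    norm_ne_zero_iff.mp (by rw [AddChar.norm_apply]; exact one_ne_zero)
  have hterm : ∀ k : ZMod q, g (ZMod.stdAddChar (a * k) * z) =
      ∑ m ∈ Finset.range (d + u + 1),
        p.coeff m * (z ^ m * z⁻¹ ^ d) *
          ZMod.stdAddChar (k * (a * ((m : ZMod q) - (d : ZMod q)))) := by
    intro k
    rw [hg _ (mul_ne_zero (hne _) hz), Polynomial.eval_eq_sum_range' (Nat.lt_succ_of_le hp),
      Finset.mul_sum]
    refine Finset.sum_congr rfl fun m _ => ?_
    have : ZMod.stdAddChar (k * (a * ((m : ZMod q) - (d : ZMod q)))) =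
        ZMod.stdAddChar (a * k) ^ m * (ZMod.stdAddChar (a * k))⁻¹ ^ d := by
      rw [inv_pow, ← AddChar.map_nsmul_eq_pow, ← AddChar.map_nsmul_eq_pow,
        ← AddChar.map_neg_eq_inv, ← AddChar.map_add_eq_mul]
      congr 1
      simp only [nsmul_eq_mul]
      ring
    rw [this, mul_inv, mul_pow, mul_pow]
    ring
  simp_rw [hterm]
  rw [Finset.sum_comm]
  simp_rw [← Finset.mul_sum, AddChar.sum_mulShift _ (ZMod.isPrimitive_stdAddChar q)]
  rw [Finset.sum_eq_single d]
  · rw [sub_self, mul_zero, if_pos rfl, ZMod.card, ← mul_pow, mul_inv_cancel₀ hz, one_pow]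
    ring
  · intro m hm hmd
    rw [if_neg, Nat.cast_zero, mul_zero]
    rw [ha.mul_right_eq_zero, sub_eq_zero, ZMod.natCast_eq_natCast_iff]
    intro hmod
    rw [Finset.mem_range] at hm
    rw [Nat.modEq_iff_dvd] at hmod
    obtain ⟨t, ht⟩ := hmod
    have hq : (0 : ℤ) < q := by have := NeZero.pos q; exact_mod_cast this
    have h1 : (q : ℤ) * t < q * 1 := by lia
    have h2 : (q : ℤ) * (-1) < q * t := by lia
    have h3 := lt_of_mul_lt_mul_left h1 hq.le
    have h4 := lt_of_mul_lt_mul_left h2 hq.le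
    have : t = 0 := by lia
    subst this
    lia
  · intro hd'
    exact absurd (Finset.mem_range.mpr (by lia)) hd'

end LaurentAverages

section CyclicJacobi

open Matrix

variable {q : ℕ} [NeZero q]

/-- The cyclic Jacobi matrix on `ZMod q` with zero diagonal. -/
def cyclicJacobi (b c : ZMod q → ℂ) : Matrix (ZMod q) (ZMod q) ℂ :=
  Matrix.of fun i j => (if j = i + 1 then b i else 0) + (if i = j + 1 then c j else 0)

/-- Conjugation by a diagonal matrix. -/
lemma det_scalar_sub_cyclicJacobi_gauge (b c : ZMod q → ℂ) {g : ZMod q → ℂ} (hg : ∀ i, g i ≠ 0)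
    (x : ℂ) :
    (Matrix.scalar _ x - cyclicJacobi (fun i => (g i)⁻¹ * g (i + 1) * b i)
      (fun i => (g (i + 1))⁻¹ * g i * c i)).det =
      (Matrix.scalar _ x - cyclicJacobi b c).det := by
  have h1 := Matrix.det_mul_column (fun i => (g i)⁻¹)
    (Matrix.of fun i j => g j * (Matrix.scalar (ZMod q) x - cyclicJacobi b c) i j)
  rw [Matrix.det_mul_row, ← mul_assoc, ← Finset.prod_mul_distrib] at h1
  simp only [inv_mul_cancel₀ (hg _), Finset.prod_const_one, one_mul] at h1
  rw [← h1]
  congr 1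
  ext i j
  simp only [cyclicJacobi, Matrix.sub_apply, Matrix.of_apply, Matrix.scalar_apply,
    Matrix.diagonal_apply]
  have hi := hg i
  have hj := hg j
  rw [mul_sub, mul_sub, mul_add, mul_add]
  congr 1
  · split_ifs with h
    · subst h
      field_simp
    · ring
  · congr 1
    · split_ifs with h
      · subst h
        ring
      · ring
    · split_ifs with h
      · subst h
        ring
      · ring

lemma det_scalar_sub_cyclicJacobi_shift (b c : ZMod q → ℂ) (k : ZMod q) (x : ℂ) :
    (Matrix.scalar _ x - cyclicJacobi (fun i => b (i + k)) (fun i => c (i + k))).det =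
      (Matrix.scalar _ x - cyclicJacobi b c).det := by
  rw [← Matrix.det_submatrix_equiv_self (Equiv.addRight k) (Matrix.scalar _ x - cyclicJacobi b c)]
  congr 1
  ext i j
  have h : ∀ i j : ZMod q, j + k = i + k + 1 ↔ j = i + 1 := fun i j => by
    rw [add_right_comm, add_left_inj]
  simp [cyclicJacobi, Matrix.diagonal_apply, h]

end CyclicJacobi

section Chambers

open Matrix

variable {q : ℕ} [NeZero q]

lemma stdAddChar_ne_zero (k : ZMod q) : ZMod.stdAddChar k ≠ 0 :=
  norm_ne_zero_iff.mp (by rw [AddChar.norm_apply]; exact one_ne_zero)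

/-- The upper off-diagonal of the rational chiral operator with Floquet parameter `y`. -/
noncomputable def chiralUp (a : ZMod q) (y ζ : ℂ) (i : ZMod q) : ℂ :=
  y * (1 + ZMod.stdAddChar (a * i) * ζ)

/-- The lower off-diagonal of the rational chiral operator with Floquet parameter `y`. -/
noncomputable def chiralDown (a : ZMod q) (y ζ : ℂ) (i : ZMod q) : ℂ :=
  y⁻¹ * (1 + (ZMod.stdAddChar (a * i) * ζ)⁻¹)

/-- The characteristic determinant of the rational chiral operator. -/
noncomputable def chiralDet (a : ZMod q) (x y ζ : ℂ) : ℂ :=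
  (Matrix.scalar _ x - cyclicJacobi (chiralUp a y ζ) (chiralDown a y ζ)).det

lemma chiralUp_shift (a : ZMod q) (y ζ : ℂ) (k i : ZMod q) :
    chiralUp a y (ZMod.stdAddChar (a * k) * ζ) i = chiralUp a y ζ (i + k) := by
  rw [chiralUp, chiralUp, mul_add a, AddChar.map_add_eq_mul, mul_assoc]

lemma chiralDown_shift (a : ZMod q) (y ζ : ℂ) (k i : ZMod q) :
    chiralDown a y (ZMod.stdAddChar (a * k) * ζ) i = chiralDown a y ζ (i + k) := by
  rw [chiralDown, chiralDown, mul_add a, AddChar.map_add_eq_mul, mul_assoc]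

lemma chiralDet_shift (a : ZMod q) (x y ζ : ℂ) (k : ZMod q) :
    chiralDet a x y (ZMod.stdAddChar (a * k) * ζ) = chiralDet a x y ζ := by
  rw [chiralDet, funext (chiralUp_shift a y ζ k), funext (chiralDown_shift a y ζ k),
    det_scalar_sub_cyclicJacobi_shift, chiralDet]

lemma chiralDet_gauge (a : ZMod q) (x y ζ : ℂ) (l : ZMod q) :
    chiralDet a x (ZMod.stdAddChar (1 * l) * y) ζ = chiralDet a x y ζ := by
  rw [chiralDet, chiralDet, ← det_scalar_sub_cyclicJacobi_gauge (chiralUp a y ζ) _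
    (g := fun i => ZMod.stdAddChar (l * i)) (fun i => stdAddChar_ne_zero _)]
  have h : ∀ i : ZMod q, ZMod.stdAddChar (l * (i + 1)) =
      ZMod.stdAddChar (l * i) * ZMod.stdAddChar l := fun i => by
    rw [mul_add, mul_one, AddChar.map_add_eq_mul]
  congr 4 with i
  · rw [chiralUp, chiralUp, h, inv_mul_cancel_left₀ (stdAddChar_ne_zero _), one_mul, mul_assoc]
  · rw [chiralDown, chiralDown, h, one_mul, mul_inv, mul_inv]
    have := stdAddChar_ne_zero (l * i)
    field_simp

lemma prod_shift_chiral (f : ZMod q → ℂ) (k : ZMod q) : ∏ i, f (i + k) = ∏ i, f i :=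
  Equiv.prod_comp (Equiv.addRight k) f

lemma pow_stdAddChar (k : ZMod q) : ZMod.stdAddChar k ^ q = 1 := by
  rw [← AddChar.map_nsmul_eq_pow]
  simp

lemma prod_chiralUp_gauge (a : ZMod q) (y ζ : ℂ) (l : ZMod q) :
    ∏ i, chiralUp a (ZMod.stdAddChar (1 * l) * y) ζ i = ∏ i, chiralUp a y ζ i := by
  simp only [chiralUp, mul_assoc]
  rw [Finset.prod_mul_distrib, Finset.prod_const, Finset.card_univ, ZMod.card, pow_stdAddChar,
    one_mul]

lemma prod_chiralDown_gauge (a : ZMod q) (y ζ : ℂ) (l : ZMod q) :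
    ∏ i, chiralDown a (ZMod.stdAddChar (1 * l) * y) ζ i = ∏ i, chiralDown a y ζ i := by
  simp only [chiralDown, mul_assoc, mul_inv (ZMod.stdAddChar (1 * l))]
  rw [Finset.prod_mul_distrib, Finset.prod_const, Finset.card_univ, ZMod.card, inv_pow,
    pow_stdAddChar, inv_one, one_mul]

/-- **Chambers' formula** in the chiral gauge. -/
theorem exists_chiralDet_eq (hq : 3 ≤ q) {a : ZMod q} (ha : IsUnit a) (x : ℂ) :
    ∃ C s : ℂ, (s = 1 ∨ s = -1) ∧ ∀ y ζ : ℂ, y ≠ 0 → ζ ≠ 0 →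
      chiralDet a x y ζ = C + s * (∏ i, chiralUp a y ζ i + ∏ i, chiralDown a y ζ i) := by
  have : Fact (1 < q) := ⟨by lia⟩
  have h2 : (1 : ZMod q) + 1 ≠ 0 := by
    intro h
    have : ((2 : ℕ) : ZMod q) = 0 := by rw [← h]; norm_num
    rw [ZMod.natCast_eq_zero_iff] at this
    exact absurd (Nat.le_of_dvd (by norm_num) this) (by lia)
  have hne1 : ∀ i : ZMod q, i ≠ i + 1 := fun i h => by simp at h
  have hne2 : ∀ i : ZMod q, i ≠ i + 1 + 1 := fun i h => by
    rw [add_assoc] at h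
    exact h2 (by simpa using h)
  let M : ℂ → ℂ → Matrix (ZMod q) (ZMod q) ℂ := fun y ζ =>
    Matrix.scalar _ x - cyclicJacobi (chiralUp a y ζ) (chiralDown a y ζ)
  have hMdown : ∀ y ζ i, M y ζ (i + 1) i = -chiralDown a y ζ i := by
    intro y ζ i
    simp [M, cyclicJacobi, hne2 i]
  have hMup : ∀ y ζ i, M y ζ i (i + 1) = -chiralUp a y ζ i := by
    intro y ζ i
    simp [M, cyclicJacobi, hne2 i]
  have hMzero : ∀ y ζ i j, j ≠ i + 1 → i ≠ j + 1 → M y ζ i j = if i = j then x else 0 := by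
    intro y ζ i j h h'
    simp [M, cyclicJacobi, Matrix.diagonal_apply, h, h']
  let T : Equiv.Perm (ZMod q) → ℂ → ℂ → ℂ := fun σ y ζ => ∏ i, M y ζ (σ i) i
  let r : Equiv.Perm (ZMod q) := Equiv.addRight 1
  have hr : ∀ i, r i = i + 1 := fun i => rfl
  have hr' : ∀ i, r⁻¹ i = i - 1 := fun i => by
    rw [Equiv.Perm.inv_eq_iff_eq, hr, sub_add_cancel]
  have hrr : r ≠ r⁻¹ := by
    intro h
    have := congrArg (fun σ : Equiv.Perm (ZMod q) => σ 0) h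
    simp only [hr, hr'] at this
    rw [zero_add, zero_sub] at this
    apply hne2 (-1)
    rw [neg_add_cancel, zero_add]
    exact this.symm
  let S : Finset (Equiv.Perm (ZMod q)) := (Finset.univ.erase r).erase r⁻¹
  have hdet : ∀ y ζ, chiralDet a x y ζ = ∑ σ ∈ S, (σ.sign : ℂ) * T σ y ζ +
      (r.sign : ℂ) * (-1) ^ q * (∏ i, chiralUp a y ζ i + ∏ i, chiralDown a y ζ i) := by
    intro y ζ
    have hTr : T r y ζ = (-1) ^ q * ∏ i, chiralDown a y ζ i := by
      simp only [T, hr, hMdown]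
      rw [Finset.prod_neg, Finset.card_univ, ZMod.card]
    have hTr' : T r⁻¹ y ζ = (-1) ^ q * ∏ i, chiralUp a y ζ i := by
      have : ∀ i, M y ζ (r⁻¹ i) i = -chiralUp a y ζ (i + -1) := fun i => by
        rw [hr', ← sub_eq_add_neg, ← hMup, sub_add_cancel]
      simp only [T, this]
      rw [Finset.prod_neg, Finset.card_univ, ZMod.card, prod_shift_chiral]
    rw [chiralDet, Matrix.det_apply', ← Finset.add_sum_erase _ _ (Finset.mem_univ r),
      ← Finset.add_sum_erase _ _ (Finset.mem_erase.mpr ⟨hrr.symm, Finset.mem_univ r⁻¹⟩)]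
    change (r.sign : ℂ) * T r y ζ + ((r⁻¹.sign : ℂ) * T r⁻¹ y ζ + ∑ σ ∈ S, (σ.sign : ℂ) * T σ y ζ)
      = _
    rw [hTr, hTr', Equiv.Perm.sign_inv]
    ring
  have hlow : ∀ σ ∈ S, ∃ C, ∀ y ζ : ℂ, y ≠ 0 → ζ ≠ 0 →
      ∑ l : ZMod q, ∑ k : ZMod q,
        T σ (ZMod.stdAddChar (1 * l) * y) (ZMod.stdAddChar (a * k) * ζ) = C := by
    intro σ hσ
    simp only [S, Finset.mem_erase, Finset.mem_univ, and_true] at hσ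
    let d : ZMod q → ℕ := fun i => if σ i = i + 1 then 1 else 0
    let u : ZMod q → ℕ := fun i => if i = σ i + 1 then 1 else 0
    have hd : ∑ i, d i < q := by
      have : ∃ i, σ i ≠ i + 1 := by
        by_contra! h
        exact hσ.2 (Equiv.ext h)
      obtain ⟨i, hi⟩ := this
      calc ∑ i, d i < ∑ _i : ZMod q, 1 := Finset.sum_lt_sum
            (fun i _ => by simp only [d]; split_ifs <;> lia) ⟨i, Finset.mem_univ _, by simp [d, hi]⟩
        _ = q := by simp
    have hu : ∑ i, u i < q := by
      have : ∃ i, i ≠ σ i + 1 := by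
        by_contra! h
        exact hσ.1 (Equiv.ext fun i => by rw [hr', eq_sub_iff_add_eq, ← h])
      obtain ⟨i, hi⟩ := this
      calc ∑ i, u i < ∑ _i : ZMod q, 1 := Finset.sum_lt_sum
            (fun i _ => by simp only [u]; split_ifs <;> lia) ⟨i, Finset.mem_univ _, by simp [u, hi]⟩
        _ = q := by simp
    have hζ : ∀ y i, IsLaurentOn (d i) (u i) fun ζ => M y ζ (σ i) i := by
      intro y i
      by_cases h : σ i = i + 1
      · have h' : i ≠ σ i + 1 := by rw [h]; exact hne2 i
        simp only [d, u, if_pos h, if_neg h', h, hMdown]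
        refine ⟨-Polynomial.C y⁻¹ * (Polynomial.X + Polynomial.C (ZMod.stdAddChar (a * i))⁻¹),
          ?_, fun z hz => ?_⟩
        · compute_degree
        · have := stdAddChar_ne_zero (a * i)
          simp only [chiralDown, Polynomial.eval_mul, Polynomial.eval_neg, Polynomial.eval_add,
            Polynomial.eval_C, Polynomial.eval_X, mul_inv (ZMod.stdAddChar (a * i))]
          field_simp
      · by_cases h' : i = σ i + 1
        · have hM : ∀ ζ, M y ζ (σ i) i = -chiralUp a y ζ (σ i) := fun ζ => by
            conv_lhs => rw [h']
            rw [← hMup]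
            rw [← h']
          simp only [d, u, if_neg h, if_pos h', hM]
          refine ⟨-Polynomial.C y *
            (1 + Polynomial.C (ZMod.stdAddChar (a * σ i)) * Polynomial.X), ?_, fun z hz => ?_⟩
          · compute_degree
          · simp [chiralUp]
        · simp only [d, u, if_neg h, if_neg h', hMzero y _ (σ i) i h' h]
          exact IsLaurentOn.const _
    have hy : ∀ ζ i, IsLaurentOn (d i) (u i) fun y => M y ζ (σ i) i := by
      intro ζ i
      by_cases h : σ i = i + 1
      · have h' : i ≠ σ i + 1 := by rw [h]; exact hne2 i
        simp only [d, u, if_pos h, if_neg h', h, hMdown]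
        refine ⟨Polynomial.C (-(1 + (ZMod.stdAddChar (a * i) * ζ)⁻¹)),
          (Polynomial.natDegree_C _).le.trans (by lia), fun z hz => ?_⟩
        simp only [chiralDown, Polynomial.eval_C]
        ring
      · by_cases h' : i = σ i + 1
        · have hM : ∀ y, M y ζ (σ i) i = -chiralUp a y ζ (σ i) := fun y => by
            conv_lhs => rw [h']
            rw [← hMup]
            rw [← h']
          simp only [d, u, if_neg h, if_pos h', hM]
          refine ⟨Polynomial.C (-(1 + ZMod.stdAddChar (a * σ i) * ζ)) * Polynomial.X, ?_,
            fun z hz => ?_⟩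
          · compute_degree
          · simp only [chiralUp, Polynomial.eval_mul, Polynomial.eval_C, Polynomial.eval_X]
            ring
        · simp only [d, u, if_neg h, if_neg h', hMzero _ ζ (σ i) i h' h]
          exact IsLaurentOn.const _
    have hTζ := fun y => IsLaurentOn.exists_sum_stdAddChar
      (IsLaurentOn.prod Finset.univ (hζ y)) hd hu ha
    choose C hC using hTζ
    have hTy := IsLaurentOn.exists_sum_stdAddChar
      (IsLaurentOn.sum (Finset.univ : Finset (ZMod q)) fun k =>
        IsLaurentOn.prod Finset.univ (hy (ZMod.stdAddChar (a * k) * 1))) hd hu isUnit_one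
    obtain ⟨C', hC'⟩ := hTy
    refine ⟨C', fun y ζ hy0 hζ0 => ?_⟩
    rw [← hC' y hy0]
    refine Finset.sum_congr rfl fun l _ => ?_
    exact (hC _ ζ hζ0).trans (hC _ 1 one_ne_zero).symm
  choose! C hC using hlow
  have hq0 : (q : ℂ) ≠ 0 := Nat.cast_ne_zero.mpr (NeZero.ne q)
  refine ⟨(∑ σ ∈ S, (σ.sign : ℂ) * C σ) / (q * q), (r.sign : ℂ) * (-1) ^ q, ?_, ?_⟩
  · rcases Int.units_eq_one_or r.sign with h | h <;> rcases neg_one_pow_eq_or ℂ q with h' | h' <;>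
      simp [h, h']
  · intro y ζ hy hζ
    have hav : (q * q : ℂ) * chiralDet a x y ζ = ∑ l : ZMod q, ∑ k : ZMod q,
        chiralDet a x (ZMod.stdAddChar (1 * l) * y) (ZMod.stdAddChar (a * k) * ζ) := by
      simp only [chiralDet_shift, chiralDet_gauge]
      simp [mul_assoc]
    have hprod : ∀ l k : ZMod q,
        ∏ i, chiralUp a (ZMod.stdAddChar (1 * l) * y) (ZMod.stdAddChar (a * k) * ζ) i +
          ∏ i, chiralDown a (ZMod.stdAddChar (1 * l) * y) (ZMod.stdAddChar (a * k) * ζ) i =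
        ∏ i, chiralUp a y ζ i + ∏ i, chiralDown a y ζ i := by
      intro l k
      rw [prod_chiralUp_gauge, prod_chiralDown_gauge]
      simp only [chiralUp_shift, chiralDown_shift]
      rw [prod_shift_chiral, prod_shift_chiral]
    have hsum : ∑ l : ZMod q, ∑ k : ZMod q, ∑ σ ∈ S, (σ.sign : ℂ) *
        T σ (ZMod.stdAddChar (1 * l) * y) (ZMod.stdAddChar (a * k) * ζ) =
        ∑ σ ∈ S, (σ.sign : ℂ) * C σ := by
      rw [Finset.sum_congr rfl fun l _ => Finset.sum_comm, Finset.sum_comm]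
      refine Finset.sum_congr rfl fun σ hσ => ?_
      simp only [← Finset.mul_sum]
      rw [hC σ hσ y ζ hy hζ]
    simp only [hdet _ _, hprod, Finset.sum_add_distrib] at hav
    rw [hsum] at hav
    rw [hdet]
    simp only [Finset.sum_const, Finset.card_univ, ZMod.card, nsmul_eq_mul] at hav
    field_simp
    linear_combination hav

end Chambers

section Bands

open Matrix

lemma isHermitian_cyclicJacobi {q : ℕ} {b c : ZMod q → ℂ} (h : ∀ i, c i = star (b i)) :
    (cyclicJacobi b c).IsHermitian := by
  ext i j
  simp only [cyclicJacobi, conjTranspose_apply, of_apply, h, star_add]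
  rw [add_comm]
  congr 1 <;> split_ifs <;> simp

variable {q : ℕ} [NeZero q]

lemma Matrix.IsHermitian.det_scalar_sub_eq_prod {n : Type*} [Fintype n] [DecidableEq n]
    {A : Matrix n n ℂ} (hA : A.IsHermitian) (x : ℝ) :
    (Matrix.scalar _ (x : ℂ) - A).det = ((∏ i, (x - hA.eigenvalues i) : ℝ) : ℂ) := by
  rw [← Matrix.eval_charpoly, hA.charpoly_eq, Polynomial.eval_prod]
  simp

lemma cyclicJacobi_mulVec (b c : ZMod q → ℂ) (v : ZMod q → ℂ) (i : ZMod q) :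
    (cyclicJacobi b c *ᵥ v) i = b i * v (i + 1) + c (i - 1) * v (i - 1) := by
  have h : ∀ j, i = j + 1 ↔ j = i - 1 := fun j => by rw [eq_sub_iff_add_eq, eq_comm]
  simp [cyclicJacobi, mulVec, dotProduct, add_mul, Finset.sum_add_distrib, h]

lemma inner_cyclicJacobi {b c : ZMod q → ℂ} (h : ∀ i, c i = star (b i))
    (x : EuclideanSpace ℂ (ZMod q)) :
    (inner ℂ x (toLpLin 2 2 (cyclicJacobi b c) x)).re =
      2 * ∑ i, (b i * x (i + 1) * star (x i)).re := by
  have hs : ∑ i, (c (i - 1) * x (i - 1) * star (x i)).re =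
      ∑ i, (c i * x i * star (x (i + 1))).re := by
    rw [← Equiv.sum_comp (Equiv.addRight (1 : ZMod q))]
    simp
  have hc : ∀ i, (c i * x i * star (x (i + 1))).re = (b i * x (i + 1) * star (x i)).re := by
    intro i
    rw [h, ← Complex.conj_re]
    congr 1
    simp
    ring
  rw [PiLp.inner_apply, Complex.re_sum]
  simp only [toLpLin_apply, cyclicJacobi_mulVec, RCLike.inner_apply, add_mul, Complex.add_re]
  rw [Finset.sum_add_distrib]
  change _ + ∑ i, (c (i - 1) * x (i - 1) * star (x i)).re = _
  rw [hs, Finset.sum_congr rfl fun i _ => hc i, two_mul]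
  rfl

lemma prod_one_add_stdAddChar_mul {a : ZMod q} (ha : IsUnit a) (ζ : ℂ) :
    ∏ i, (1 + ZMod.stdAddChar (a * i) * ζ) = 1 - (-ζ) ^ q := by
  have hq : 0 < q := Nat.pos_of_ne_zero (NeZero.ne q)
  have h1 : ∏ i, (1 + ZMod.stdAddChar (a * i) * ζ) =
      ∏ i : ZMod q, (1 + ZMod.stdAddChar i * ζ) := by
    obtain ⟨u, rfl⟩ := ha
    exact Equiv.prod_comp (Units.mulLeft u) fun i : ZMod q => 1 + ZMod.stdAddChar i * ζ
  have hprim := Complex.isPrimitiveRoot_exp q hq.ne'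
  have himg : Finset.univ.image (ZMod.stdAddChar : ZMod q → ℂ) =
      Polynomial.nthRootsFinset q (1 : ℂ) := by
    apply Finset.eq_of_subset_of_card_le
    · intro z hz
      obtain ⟨k, -, rfl⟩ := Finset.mem_image.mp hz
      rw [Polynomial.mem_nthRootsFinset hq]
      exact pow_stdAddChar k
    · rw [hprim.card_nthRootsFinset, Finset.card_image_of_injective _ ZMod.injective_stdAddChar,
        Finset.card_univ, ZMod.card]
  rw [h1, ← one_pow q, hprim.pow_sub_pow_eq_prod_sub_mul _ _ hq, ← himg,
    Finset.prod_image fun x _ y _ h => ZMod.injective_stdAddChar h]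
  simp

lemma chiralDown_eq_star {a : ZMod q} {y ζ : ℂ} (hy : ‖y‖ = 1) (hζ : ‖ζ‖ = 1) (i : ZMod q) :
    chiralDown a y ζ i = star (chiralUp a y ζ i) := by
  have h : ∀ z : ℂ, ‖z‖ = 1 → z⁻¹ = star z := fun z hz => by
    rw [Complex.inv_def, Complex.normSq_eq_norm_sq, hz]
    simp
  rw [chiralDown, chiralUp, h y hy, h _ (by rw [norm_mul, AddChar.norm_apply, hζ, one_mul])]
  simp [mul_comm]

lemma isHermitian_chiral {a : ZMod q} {y ζ : ℂ} (hy : ‖y‖ = 1) (hζ : ‖ζ‖ = 1) :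
    (cyclicJacobi (chiralUp a y ζ) (chiralDown a y ζ)).IsHermitian :=
  isHermitian_cyclicJacobi (chiralDown_eq_star hy hζ)

lemma prod_chiralUp_add_prod_chiralDown {a : ZMod q} (ha : IsUnit a) {y ζ : ℂ} (hy : ‖y‖ = 1)
    (hζ : ‖ζ‖ = 1) : ∏ i, chiralUp a y ζ i + ∏ i, chiralDown a y ζ i =
      ((2 * (y ^ q * (1 - (-ζ) ^ q)).re : ℝ) : ℂ) := by
  have h : ∏ i, chiralUp a y ζ i = y ^ q * (1 - (-ζ) ^ q) := by
    simp only [chiralUp]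
    rw [Finset.prod_mul_distrib, prod_one_add_stdAddChar_mul ha]
    simp
  simp only [chiralDown_eq_star hy hζ]
  rw [← star_prod, h]
  exact Complex.add_conj _

/-- The spectra of all unitary Floquet fibres of the rational chiral operator are covered by `q`
intervals of total length `O(1/q)`. -/
theorem exists_bands (hq : 3 ≤ q) {a : ZMod q} (ha : IsUnit a) :
    ∃ l r : ZMod q → ℝ, (∀ i, l i ≤ r i) ∧ ∑ i, (r i - l i) ≤ 8 * π / q ∧
      ∀ (y ζ : ℂ) (hy : ‖y‖ = 1) (hζ : ‖ζ‖ = 1) (j : ZMod q), ∃ i,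
        (isHermitian_chiral (a := a) hy hζ).eigenvalues j ∈ Set.Icc (l i) (r i) := by
  have : Fact (1 < q) := ⟨by lia⟩
  have hq0 : (q : ℝ) ≠ 0 := Nat.cast_ne_zero.mpr (NeZero.ne q)
  have hqc : (q : ℂ) ≠ 0 := Nat.cast_ne_zero.mpr (NeZero.ne q)
  set y₀ : ℂ := Complex.exp (Complex.I * ((π / q : ℝ) : ℂ)) with hy₀
  have hy₀n : ‖y₀‖ = 1 := Complex.norm_exp_I_mul_ofReal _
  have hy₀0 : y₀ ≠ 0 := Complex.exp_ne_zero _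
  have hy₀q : y₀ ^ q = -1 := by
    rw [hy₀, ← Complex.exp_nat_mul, ← Complex.exp_pi_mul_I]
    congr 1
    push_cast
    field_simp
  set ζ₀ : ℂ := -(ZMod.stdAddChar a * y₀) with hζ₀
  have hζ₀n : ‖ζ₀‖ = 1 := by rw [hζ₀, norm_neg, norm_mul, AddChar.norm_apply, hy₀n, one_mul]
  have hζ₀0 : ζ₀ ≠ 0 := norm_ne_zero_iff.mp (by rw [hζ₀n]; exact one_ne_zero)
  have hζ₀q : (-ζ₀) ^ q = -1 := by
    rw [hζ₀, neg_neg, mul_pow, pow_stdAddChar, hy₀q, one_mul]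
  set b := chiralUp a 1 ζ₀ with hb
  set c := chiralDown a 1 ζ₀ with hc
  have hcb : ∀ i, c i = star (b i) := chiralDown_eq_star norm_one hζ₀n
  let b' : ZMod q → ℂ := fun i => if i = -1 then -b i else b i
  let c' : ZMod q → ℂ := fun i => if i = -1 then -c i else c i
  have hcb' : ∀ i, c' i = star (b' i) := fun i => by
    simp only [c', b', hcb]
    split_ifs <;> simp
  have hA := isHermitian_chiral (a := a) norm_one hζ₀n
  have hB := isHermitian_cyclicJacobi hcb'
  set A := cyclicJacobi b c
  set B := cyclicJacobi b' c'
  set β : ℝ := ‖b (-1)‖ with hβ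
  have hβle : β ≤ π / q := by
    have : b (-1) = -(y₀ - 1) := by
      rw [hb, chiralUp, hζ₀, mul_neg_one, AddChar.map_neg_eq_inv]
      have := stdAddChar_ne_zero a
      field_simp
      ring
    rw [hβ, this, norm_neg]
    refine Real.norm_exp_I_mul_ofReal_sub_one_le.trans_eq ?_
    rw [Real.norm_of_nonneg (by positivity)]
  let F : Matrix (ZMod q) (ZMod q) ℂ :=
    Matrix.diagonal fun i => if i = -1 ∨ i = 0 then ((2 * β : ℝ) : ℂ) else 0
  have hF : F.IsHermitian := by
    refine isHermitian_diagonal_of_self_adjoint _ ?_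
    ext i
    simp only [Pi.star_apply]
    split_ifs <;> simp
  have hC : (B + F).IsHermitian := hB.add hF
  have hFform : ∀ x : EuclideanSpace ℂ (ZMod q), (inner ℂ x (toLpLin 2 2 F x)).re =
      2 * β * (‖x (-1)‖ ^ 2 + ‖x 0‖ ^ 2) := by
    intro x
    rw [PiLp.inner_apply, Complex.re_sum]
    have h : ∀ i, (inner ℂ (x i) (toLpLin 2 2 F x i)).re =
        (if i = -1 then 2 * β * ‖x (-1)‖ ^ 2 else 0) + if i = 0 then 2 * β * ‖x 0‖ ^ 2 else 0 := by
      intro i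
      have h10 : (0 : ZMod q) ≠ -1 := by simp
      have hxx : ∀ z : ℂ, (z * (starRingEnd ℂ) z).re = ‖z‖ ^ 2 := fun z => by
        rw [Complex.mul_conj, Complex.ofReal_re, Complex.normSq_eq_norm_sq]
      simp only [toLpLin_apply, F, mulVec_diagonal, RCLike.inner_apply]
      by_cases h1 : i = -1
      · subst h1
        simp only [true_or, if_true, mul_assoc, Complex.re_ofReal_mul, h10.symm, if_false]
        rw [hxx]
        ring
      · by_cases h2 : i = 0
        · subst h2
          simp only [or_true, if_true, h10, if_false, mul_assoc, Complex.re_ofReal_mul]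
          rw [hxx]
          ring
        · simp [h1, h2]
    rw [Finset.sum_congr rfl fun i _ => h i, Finset.sum_add_distrib]
    simp
    ring
  have hadd : ∀ x : EuclideanSpace ℂ (ZMod q), (inner ℂ x (toLpLin 2 2 (B + F) x)).re =
      (inner ℂ x (toLpLin 2 2 B x)).re + 2 * β * (‖x (-1)‖ ^ 2 + ‖x 0‖ ^ 2) := by
    intro x
    rw [← hFform, map_add, LinearMap.add_apply, inner_add_right, Complex.add_re]
  have hBC : ∀ x : EuclideanSpace ℂ (ZMod q),
      (inner ℂ x (toLpLin 2 2 B x)).re ≤ (inner ℂ x (toLpLin 2 2 (B + F) x)).re := by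
    intro x
    rw [hadd]
    have : 0 ≤ β := norm_nonneg _
    have : 0 ≤ 2 * β * (‖x (-1)‖ ^ 2 + ‖x 0‖ ^ 2) := by positivity
    linarith
  have hAC : ∀ x : EuclideanSpace ℂ (ZMod q),
      (inner ℂ x (toLpLin 2 2 A x)).re ≤ (inner ℂ x (toLpLin 2 2 (B + F) x)).re := by
    intro x
    rw [hadd, inner_cyclicJacobi hcb, inner_cyclicJacobi hcb',
      ← Finset.add_sum_erase _ _ (Finset.mem_univ (-1 : ZMod q)),
      ← Finset.add_sum_erase Finset.univ (fun i => (b' i * x (i + 1) * star (x i)).re)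
        (Finset.mem_univ (-1 : ZMod q))]
    have he : ∀ i ∈ Finset.univ.erase (-1 : ZMod q), (b' i * x (i + 1) * star (x i)).re =
        (b i * x (i + 1) * star (x i)).re := by
      intro i hi
      simp only [b', if_neg (Finset.ne_of_mem_erase hi)]
    rw [Finset.sum_congr rfl he]
    simp only [b', if_true, neg_add_cancel, neg_mul, Complex.neg_re]
    have h1 : (b (-1) * x 0 * star (x (-1))).re ≤ β * ‖x 0‖ * ‖x (-1)‖ := by
      refine (Complex.re_le_norm _).trans_eq ?_
      simp [hβ]
    have h2 : 0 ≤ β := norm_nonneg _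
    nlinarith [mul_nonneg h2 (sq_nonneg (‖x 0‖ - ‖x (-1)‖))]
  have htr : ∀ b c : ZMod q → ℂ, (cyclicJacobi b c).trace = 0 := by
    intro b c
    simp [cyclicJacobi, Matrix.trace]
  have htrF : F.trace.re = 4 * β := by
    simp only [F, Matrix.trace_diagonal]
    rw [Finset.sum_ite, Finset.sum_const_zero, add_zero, Finset.sum_const, Finset.filter_or,
      Finset.card_union_of_disjoint (by simp [Finset.filter_eq', eq_comm])]
    simp [Finset.filter_eq']
    ring
  have hsum := hA.sum_abs_eigenvalues_sub_le hB hC hAC hBC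
  rw [Matrix.trace_add, htr, htr, zero_add, htrF] at hsum
  refine ⟨fun i => min (hA.eigenvalues i) (hB.eigenvalues i),
    fun i => max (hA.eigenvalues i) (hB.eigenvalues i), fun i => min_le_max, ?_, ?_⟩
  · simp only [max_sub_min_eq_abs']
    refine hsum.trans ?_
    simp only [Complex.zero_re, sub_zero]
    calc 2 * (4 * β) = 8 * β := by ring
      _ ≤ 8 * (π / q) := by gcongr
      _ = 8 * π / q := by ring
  · intro y ζ hy hζ j
    set E := (isHermitian_chiral (a := a) hy hζ).eigenvalues j with hE
    apply exists_mem_uIcc_of_prod_mul_prod_nonpos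
    obtain ⟨C, s, hs, h⟩ := exists_chiralDet_eq hq ha (E : ℂ)
    have hy0 : y ≠ 0 := norm_ne_zero_iff.mp (by rw [hy]; exact one_ne_zero)
    have hζ0 : ζ ≠ 0 := norm_ne_zero_iff.mp (by rw [hζ]; exact one_ne_zero)
    have e1 := h y ζ hy0 hζ0
    have e0 : ∏ i, (E - (isHermitian_chiral (a := a) hy hζ).eigenvalues i) = 0 :=
      Finset.prod_eq_zero (Finset.mem_univ j) (sub_self _)
    rw [prod_chiralUp_add_prod_chiralDown ha hy hζ, chiralDet,
      (isHermitian_chiral (a := a) hy hζ).det_scalar_sub_eq_prod, e0] at e1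
    have e2 := h 1 ζ₀ one_ne_zero hζ₀0
    rw [prod_chiralUp_add_prod_chiralDown ha norm_one hζ₀n, chiralDet, hζ₀q,
      hA.det_scalar_sub_eq_prod] at e2
    have e3 := h y₀ ζ₀ hy₀0 hζ₀0
    have hdet : chiralDet a E y₀ ζ₀ = (Matrix.scalar _ (E : ℂ) - B).det := by
      rw [← det_scalar_sub_cyclicJacobi_gauge b' c' (g := fun i => y₀ ^ i.val)
        (fun i => pow_ne_zero _ hy₀0), chiralDet]
      have hval : ∀ i : ZMod q, i ≠ -1 → (i + 1).val = i.val + 1 := by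
        intro i hi
        rw [ZMod.val_add_of_lt, ZMod.val_one]
        rw [ZMod.val_one]
        have h1 := i.val_lt
        by_contra hcon
        apply hi
        have : i.val + 1 = q := by lia
        rw [← ZMod.natCast_zmod_val i, eq_neg_iff_add_eq_zero]
        exact_mod_cast (congrArg (Nat.cast : ℕ → ZMod q) this).trans (by simp)
      have hlast : (-1 : ZMod q).val + 1 = q := by
        obtain ⟨m, rfl⟩ : ∃ m, q = m + 1 := ⟨q - 1, by lia⟩
        rw [ZMod.val_neg_one]
      have hyl : y₀ ^ (-1 : ZMod q).val * y₀ = -1 := by rw [← pow_succ, hlast, hy₀q]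
      have hyl' : y₀ ^ (-1 : ZMod q).val = -y₀⁻¹ := by
        rw [eq_neg_iff_add_eq_zero, ← mul_eq_zero_iff_right hy₀0, add_mul, hyl,
          inv_mul_cancel₀ hy₀0]
        ring
      congr 3 with i
      · by_cases hi : i = -1
        · subst hi
          simp only [b', if_true, neg_add_cancel, ZMod.val_zero, pow_zero, hyl', hb, chiralUp]
          rw [inv_neg, inv_inv]
          ring
        · simp only [b', if_neg hi, hval i hi, pow_succ, hb, chiralUp]
          field_simp
      · by_cases hi : i = -1
        · subst hi
          simp only [c', if_true, neg_add_cancel, ZMod.val_zero, pow_zero, hyl', hc, chiralDown]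
          ring
        · simp only [c', if_neg hi, hval i hi, pow_succ, hc, chiralDown]
          field_simp
    rw [prod_chiralUp_add_prod_chiralDown ha hy₀n hζ₀n, hdet, hζ₀q, hy₀q,
      hB.det_scalar_sub_eq_prod] at e3
    set T := 2 * (y ^ q * (1 - (-ζ) ^ q)).re with hT
    have hTle : |T| ≤ 4 := by
      rw [hT, abs_mul, abs_two]
      have h1 : |(y ^ q * (1 - (-ζ) ^ q)).re| ≤ 2 := by
        refine (Complex.abs_re_le_norm _).trans ?_
        rw [norm_mul, norm_pow, hy, one_pow, one_mul]
        refine (norm_sub_le _ _).trans ?_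
        simp [hζ]
        norm_num
      linarith
    have hs2 : s ^ 2 = 1 := by rcases hs with rfl | rfl <;> norm_num
    have hprod : (∏ i, (E - hA.eigenvalues i)) * ∏ i, (E - hB.eigenvalues i) = T ^ 2 - 16 := by
      apply Complex.ofReal_injective
      rw [Complex.ofReal_mul, e2, e3]
      push_cast at e1 ⊢
      norm_num
      linear_combination ((T : ℂ) * s - C) * e1 + ((T : ℂ) ^ 2 - 16) * hs2
    rw [hprod]
    nlinarith [sq_abs T, abs_nonneg T]

end Bands

section Floquet

lemma exists_pos_le_mul_of_sum_le {ι : Type*} {s : Finset ι} {P Q : ι → ℝ} {c : ℝ}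
    (hP : ∀ i ∈ s, 0 ≤ P i) (hQ : ∀ i ∈ s, 0 ≤ Q i) (hpos : 0 < ∑ i ∈ s, P i)
    (h : ∑ i ∈ s, Q i ≤ c * ∑ i ∈ s, P i) : ∃ i ∈ s, 0 < P i ∧ Q i ≤ c * P i := by
  by_contra! hcon
  obtain ⟨j, hj, hj0⟩ := Finset.exists_ne_zero_of_sum_ne_zero hpos.ne'
  have hj0' : 0 < P j := lt_of_le_of_ne (hP j hj) hj0.symm
  have : ∑ i ∈ s, c * P i < ∑ i ∈ s, Q i := by
    refine Finset.sum_lt_sum (fun i hi => ?_) ⟨j, hj, hcon j hj hj0'⟩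
    rcases (hP i hi).eq_or_lt with h0 | h0
    · rw [← h0, mul_zero]
      exact hQ i hi
    · exact (hcon i hi h0).le
  rw [← Finset.mul_sum] at this
  exact this.not_ge h

lemma stdAddChar_zpow_neg {N : ℕ} [NeZero N] (k : ZMod N) (n : ℤ) :
    ZMod.stdAddChar k ^ (-n) = ZMod.stdAddChar (k * -(n : ZMod N)) := by
  rw [← AddChar.map_zsmul_eq_zpow]
  congr 1
  rw [zsmul_eq_mul]
  push_cast
  ring

/-- Discrete Parseval identity. -/
theorem sum_norm_sq_fourier {N : ℕ} [NeZero N] {s : Finset ℤ}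
    (hs : Set.InjOn (fun n : ℤ => (n : ZMod N)) s) {f : ℤ → ℂ} (hf : ∀ n ∉ s, f n = 0) :
    ∑ k : ZMod N, ‖∑' n, f n * ZMod.stdAddChar k ^ (-n)‖ ^ 2 = N * ∑' n, ‖f n‖ ^ 2 := by
  have h1 : ∀ k : ZMod N, ∑' n, f n * ZMod.stdAddChar k ^ (-n) =
      ∑ n ∈ s, f n * ZMod.stdAddChar (k * -(n : ZMod N)) := fun k => by
    rw [tsum_eq_sum fun n hn => by rw [hf n hn, zero_mul]]
    exact Finset.sum_congr rfl fun n _ => by rw [stdAddChar_zpow_neg]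
  have h2 : ∑' n, ‖f n‖ ^ 2 = ∑ n ∈ s, ‖f n‖ ^ 2 :=
    tsum_eq_sum fun n hn => by rw [hf n hn]; simp
  simp only [h1]
  rw [h2]
  apply Complex.ofReal_injective
  push_cast
  simp only [← Complex.mul_conj', map_sum, map_mul, Finset.sum_mul_sum]
  rw [Finset.sum_comm, Finset.mul_sum]
  refine Finset.sum_congr rfl fun n hn => ?_
  rw [Finset.sum_comm, Finset.sum_eq_single n]
  · have : ∀ k : ZMod N, f n * ZMod.stdAddChar (k * -(n : ZMod N)) *
        ((starRingEnd ℂ) (f n) * (starRingEnd ℂ) (ZMod.stdAddChar (k * -(n : ZMod N)))) =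
        f n * (starRingEnd ℂ) (f n) := fun k => by
      have h := Complex.mul_conj' (ZMod.stdAddChar (k * -(n : ZMod N)))
      rw [AddChar.norm_apply, Complex.ofReal_one] at h
      linear_combination f n * (starRingEnd ℂ) (f n) * h
    rw [Finset.sum_congr rfl fun k _ => this k]
    simp
  · intro m hm hmn
    have hne : (m : ZMod N) - (n : ZMod N) ≠ 0 := fun h => hmn (hs hm hn (sub_eq_zero.mp h))
    have : ∀ k : ZMod N, f n * ZMod.stdAddChar (k * -(n : ZMod N)) *
        ((starRingEnd ℂ) (f m) * (starRingEnd ℂ) (ZMod.stdAddChar (k * -(m : ZMod N)))) =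
        f n * (starRingEnd ℂ) (f m) *
          ZMod.stdAddChar (k * ((m : ZMod N) - (n : ZMod N))) := fun k => by
      rw [← AddChar.map_neg_eq_conj, mul_sub, sub_eq_add_neg, AddChar.map_add_eq_mul, ← mul_neg,
        ← mul_neg, neg_neg]
      ring
    rw [Finset.sum_congr rfl fun k _ => this k, ← Finset.mul_sum,
      AddChar.sum_mulShift _ (ZMod.isPrimitive_stdAddChar N), if_neg hne]
    simp
  · exact fun h => absurd hn h

/-- The Jacobi operator with zero diagonal and off-diagonal entries `b`. -/
def jacobi (b φ : ℤ → ℂ) (n : ℤ) : ℂ := b n * φ (n + 1) + star (b (n - 1)) * φ (n - 1)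

lemma finite_support_jacobi {b φ : ℤ → ℂ} (hφ : φ.support.Finite) :
    (jacobi b φ).support.Finite := by
  refine ((hφ.preimage (add_left_injective (1 : ℤ)).injOn).union
    (hφ.preimage (sub_left_injective (b := (1 : ℤ))).injOn)).subset fun n hn => ?_
  by_contra hcon
  simp only [Set.mem_union, Set.mem_preimage, Function.mem_support, not_or, not_not] at hcon
  exact hn (by simp [jacobi, hcon.1, hcon.2])

lemma summable_norm_sq_of_finite_support {φ : ℤ → ℂ} (hφ : φ.support.Finite) :
    Summable fun n => ‖φ n‖ ^ 2 :=
  summable_of_hasFiniteSupport (hφ.subset fun n hn h => hn (by simp [h]))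

/-- Approximate eigenvectors of a periodic Jacobi operator descend to some Floquet fibre. -/
theorem exists_floquet_fibre {q : ℕ} [NeZero q] (β : ZMod q → ℂ) {φ : ℤ → ℂ}
    (hφ : φ.support.Finite) (hφ0 : 0 < ∑' n, ‖φ n‖ ^ 2) {E η : ℝ}
    (h : ∑' n, ‖jacobi (fun n => β n) φ n - E * φ n‖ ^ 2 ≤ η ^ 2 * ∑' n, ‖φ n‖ ^ 2) :
    ∃ (y : ℂ) (v : ZMod q → ℂ), ‖y‖ = 1 ∧ 0 < ∑ i, ‖v i‖ ^ 2 ∧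
      ∑ i, ‖(Matrix.mulVec (cyclicJacobi (fun i => y * β i) fun i => y⁻¹ * star (β i)) v) i -
        E * v i‖ ^ 2 ≤ η ^ 2 * ∑ i, ‖v i‖ ^ 2 := by
  set g : ℤ → ℂ := fun n => jacobi (fun n => β n) φ n - E * φ n with hg
  have hgfin : g.support.Finite := by
    refine ((finite_support_jacobi (b := fun n => β n) hφ).union hφ).subset fun n hn => ?_
    by_contra hcon
    simp only [Set.mem_union, Function.mem_support, not_or, not_not] at hcon
    exact hn (by simp [hg, hcon.1, hcon.2])
  set s : Finset ℤ := hφ.toFinset ∪ hgfin.toFinset with hs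
  obtain ⟨R, hR⟩ : ∃ R : ℕ, ∀ n ∈ s, |n| ≤ R := by
    refine ⟨s.sup Int.natAbs, fun n hn => ?_⟩
    have := Finset.le_sup (f := Int.natAbs) hn
    rw [Int.abs_eq_natAbs]
    exact_mod_cast this
  let N := 2 * R + 1
  have hinj : Set.InjOn (fun n : ℤ => (n : ZMod N)) s := by
    intro m hm n hn hmn
    have h1 := (ZMod.intCast_eq_intCast_iff_dvd_sub _ _ _).mp hmn
    have h2 := hR m hm
    have h3 := hR n hn
    rw [abs_le] at h2 h3
    have := Int.eq_zero_of_abs_lt_dvd h1 (by rw [abs_lt]; simp only [N]; push_cast; lia)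
    lia
  let F : (ℤ → ℂ) → ZMod N → ZMod q → ℂ := fun f k i =>
    ∑' n : ℤ, (if (n : ZMod q) = i then f n else 0) * ZMod.stdAddChar k ^ (-n)
  have hpars : ∀ f : ℤ → ℂ, (∀ n ∉ s, f n = 0) →
      ∑ k, ∑ i, ‖F f k i‖ ^ 2 = N * ∑' n, ‖f n‖ ^ 2 := by
    intro f hf
    rw [Finset.sum_comm]
    have hterm : ∀ i : ZMod q, ∑ k, ‖F f k i‖ ^ 2 =
        N * ∑ n ∈ s, if (n : ZMod q) = i then ‖f n‖ ^ 2 else 0 := by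
      intro i
      rw [sum_norm_sq_fourier hinj fun n hn => by rw [hf n hn, ite_self],
        tsum_eq_sum fun n hn => by rw [hf n hn, ite_self]; simp]
      congr 1
      refine Finset.sum_congr rfl fun n _ => ?_
      split_ifs <;> simp
    simp only [hterm]
    rw [← Finset.mul_sum, Finset.sum_comm,
      tsum_eq_sum (s := s) fun n hn => by rw [hf n hn]; simp]
    simp
  have hFg : ∀ k i, F g k i = (Matrix.mulVec (cyclicJacobi (fun i => ZMod.stdAddChar k * β i)
      fun i => (ZMod.stdAddChar k)⁻¹ * star (β i)) (F φ k)) i - E * F φ k i := by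
    intro k i
    set t := ZMod.stdAddChar k
    have ht : t ≠ 0 := stdAddChar_ne_zero k
    have hsum : ∀ i : ZMod q, Summable fun n : ℤ =>
        (if (n : ZMod q) = i then φ n else 0) * t ^ (-n) := fun i =>
      summable_of_hasFiniteSupport (hφ.subset fun n hn h => hn (by simp [h]))
    have hup : t * F φ k (i + 1) =
        ∑' n : ℤ, (if (n : ZMod q) = i then φ (n + 1) else 0) * t ^ (-n) := by
      simp only [F]
      rw [← tsum_mul_left, ← (Equiv.addRight (1 : ℤ)).tsum_eq]
      refine tsum_congr fun n => ?_
      simp only [Equiv.coe_addRight, Int.cast_add, Int.cast_one, add_left_inj]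
      rw [neg_add, zpow_add₀ ht, zpow_neg_one]
      change t * (_ * (_ * t⁻¹)) = _
      field_simp
    have hdown : t⁻¹ * F φ k (i - 1) =
        ∑' n : ℤ, (if (n : ZMod q) = i then φ (n - 1) else 0) * t ^ (-n) := by
      simp only [F]
      rw [← tsum_mul_left, ← (Equiv.subRight (1 : ℤ)).tsum_eq]
      refine tsum_congr fun n => ?_
      simp only [Equiv.subRight_apply, Int.cast_sub, Int.cast_one, sub_left_inj]
      rw [neg_sub, sub_eq_add_neg 1 n, zpow_add₀ ht, zpow_one]
      change t⁻¹ * (_ * (t * _)) = _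
      field_simp
    have hsup : Summable fun n : ℤ =>
        (if (n : ZMod q) = i then φ (n + 1) else 0) * t ^ (-n) :=
      summable_of_hasFiniteSupport ((hφ.preimage (add_left_injective (1 : ℤ)).injOn).subset
        fun n hn h => hn (by simp only at h; simp [h]))
    have hsdown : Summable fun n : ℤ =>
        (if (n : ZMod q) = i then φ (n - 1) else 0) * t ^ (-n) :=
      summable_of_hasFiniteSupport ((hφ.preimage (sub_left_injective (b := (1 : ℤ))).injOn).subset
        fun n hn h => hn (by simp only at h; simp [h]))
    rw [cyclicJacobi_mulVec, mul_comm t (β i), mul_assoc, hup, mul_comm t⁻¹, mul_assoc, hdown]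
    simp only [F]
    rw [← tsum_mul_left, ← tsum_mul_left, ← tsum_mul_left,
      ← (hsup.mul_left _).tsum_add (hsdown.mul_left _),
      ← ((hsup.mul_left _).add (hsdown.mul_left _)).tsum_sub ((hsum i).mul_left _)]
    refine tsum_congr fun n => ?_
    by_cases hn : (n : ZMod q) = i
    · simp only [if_pos hn, hg, jacobi, Int.cast_sub, Int.cast_one]
      rw [hn]
      ring
    · simp [hn]
  have hN : (0 : ℝ) < N := by positivity
  have hφs : ∀ n ∉ s, φ n = 0 := fun n hn => by
    by_contra h
    exact hn (Finset.mem_union_left _ (by simpa using h))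
  have hgs : ∀ n ∉ s, g n = 0 := fun n hn => by
    by_contra h
    exact hn (Finset.mem_union_right _ (by simpa using h))
  obtain ⟨k, -, hk0, hk⟩ := exists_pos_le_mul_of_sum_le (s := Finset.univ)
    (P := fun k => ∑ i, ‖F φ k i‖ ^ 2) (Q := fun k => ∑ i, ‖F g k i‖ ^ 2) (c := η ^ 2)
    (fun k _ => by positivity) (fun k _ => by positivity)
    (by rw [hpars φ hφs]; positivity)
    (by rw [hpars φ hφs, hpars g hgs]; nlinarith)
  exact ⟨ZMod.stdAddChar k, F φ k, AddChar.norm_apply _ _, hk0, by simpa only [← hFg] using hk⟩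

/-- Approximate eigenvalues of the rational chiral operator are close to its bands. -/
theorem exists_bands_approx {q : ℕ} [NeZero q] (hq : 3 ≤ q) {a : ZMod q} (ha : IsUnit a) :
    ∃ l r : ZMod q → ℝ, (∀ i, l i ≤ r i) ∧ ∑ i, (r i - l i) ≤ 8 * π / q ∧
      ∀ (ζ : ℂ), ‖ζ‖ = 1 → ∀ φ : ℤ → ℂ, φ.support.Finite → 0 < ∑' n, ‖φ n‖ ^ 2 →
        ∀ E η : ℝ, 0 ≤ η →
        ∑' n, ‖jacobi (fun n : ℤ => 1 + ZMod.stdAddChar (a * (n : ZMod q)) * ζ) φ n - E * φ n‖ ^ 2 ≤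
          η ^ 2 * ∑' n, ‖φ n‖ ^ 2 →
        ∃ i, E ∈ Set.Icc (l i - η) (r i + η) := by
  obtain ⟨l, r, hlr, hsum, hmem⟩ := exists_bands hq ha
  refine ⟨l, r, hlr, hsum, fun ζ hζ φ hφ hφ0 E η hη h => ?_⟩
  obtain ⟨y, v, hy, hv, hle⟩ :=
    exists_floquet_fibre (fun i => 1 + ZMod.stdAddChar (a * i) * ζ) hφ hφ0 h
  have hdown : (fun i : ZMod q => y⁻¹ * star (1 + ZMod.stdAddChar (a * i) * ζ)) =
      chiralDown a y ζ := by
    funext i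
    have h1 := chiralDown_eq_star (a := a) (norm_one (α := ℂ)) hζ i
    simp only [chiralDown, chiralUp, inv_one, one_mul] at h1
    rw [chiralDown, h1]
  rw [hdown] at hle
  obtain ⟨j, hj⟩ := (isHermitian_chiral (a := a) hy hζ).exists_abs_eigenvalues_sub_le hη hv hle
  obtain ⟨i, hi⟩ := hmem y ζ hy hζ j
  rw [abs_le] at hj
  exact ⟨i, by linarith [hi.1, hj.2], by linarith [hi.2, hj.1]⟩

end Floquet

section Localization

lemma exists_forall_add_one_eq (ω : ℤ → ℝ) : ∃ d : ℤ → ℝ, ∀ n, d (n + 1) = d n + ω n := by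
  refine ⟨fun n => match n with
    | Int.ofNat n => ∑ k ∈ Finset.range n, ω k
    | Int.negSucc n => -∑ k ∈ Finset.range (n + 1), ω (Int.negSucc k), fun n => ?_⟩
  match n with
  | Int.ofNat n => exact Finset.sum_range_succ (fun k : ℕ => ω k) n
  | Int.negSucc 0 => simp
  | Int.negSucc (n + 1) =>
    change -∑ k ∈ Finset.range (n + 1), ω (Int.negSucc k) =
      -∑ k ∈ Finset.range (n + 1 + 1), ω (Int.negSucc k) + ω (Int.negSucc (n + 1))
    rw [Finset.sum_range_succ _ (n + 1)]
    ring

lemma sum_Ico_eq_sub {ω d : ℤ → ℝ} (hd : ∀ n, d (n + 1) = d n + ω n) (k : ℤ) (M : ℕ) :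
    ∑ i ∈ Finset.range M, ω (k + i) = d (k + M) - d k := by
  induction M with
  | zero => simp
  | succ M ih =>
    rw [Finset.sum_range_succ, ih]
    push_cast
    rw [← add_assoc, hd]
    ring

lemma card_filter_abs_sub_lt_le (J : Finset ℤ) (x : ℝ) {R : ℝ} (hR : 0 ≤ R) :
    ((J.filter fun j : ℤ => |x - j| < R).card : ℝ) ≤ 2 * R + 1 := by
  have hsub : (J.filter fun j : ℤ => |x - j| < R) ⊆ Finset.Icc ⌈x - R⌉ ⌊x + R⌋ := by
    intro j hj
    have h := abs_lt.mp (Finset.mem_filter.mp hj).2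
    rw [Finset.mem_Icc, Int.ceil_le, Int.le_floor]
    constructor <;> linarith
  refine (Nat.cast_le.mpr (Finset.card_le_card hsub)).trans ?_
  rw [Int.card_Icc]
  have h1 : ((⌊x + R⌋ + 1 - ⌈x - R⌉ : ℤ) : ℝ) ≤ 2 * R + 1 := by
    push_cast
    linarith [Int.floor_le (x + R), Int.le_ceil (x - R)]
  rcases le_total 0 (⌊x + R⌋ + 1 - ⌈x - R⌉) with h | h
  · rw [← Int.cast_natCast, Int.toNat_of_nonneg h]
    exact h1
  · rw [Int.toNat_of_nonpos h]
    push_cast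
    linarith

lemma le_card_Icc_ceil_floor (x R : ℝ) :
    R - 1 ≤ ((Finset.Icc ⌈x - R / 2⌉ ⌊x + R / 2⌋).card : ℝ) := by
  rw [Int.card_Icc]
  refine le_trans ?_ (Int.cast_le.mpr (Int.self_le_toNat (⌊x + R / 2⌋ + 1 - ⌈x - R / 2⌉)))
  push_cast
  linarith [Int.lt_floor_add_one (x + R / 2), Int.ceil_lt_add_one (x - R / 2)]

/-- A tent of height and half-width `R`, centred at `j`. -/
def tent (R j x : ℝ) : ℝ := max 0 (R - |x - j|)

lemma tent_nonneg (R j x : ℝ) : 0 ≤ tent R j x := le_max_left _ _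

lemma tent_le {R : ℝ} (hR : 0 ≤ R) (j x : ℝ) : tent R j x ≤ R :=
  max_le hR (by linarith [abs_nonneg (x - j)])

lemma tent_eq_zero {R j x : ℝ} (h : ¬ |x - j| < R) : tent R j x = 0 :=
  max_eq_left (by linarith)

lemma abs_tent_sub_le (R j x y : ℝ) : |tent R j x - tent R j y| ≤ |x - y| := by
  rw [tent, tent, max_comm 0, max_comm 0]
  refine (abs_max_sub_max_le_abs _ _ _).trans ?_
  rw [sub_sub_sub_cancel_left, abs_sub_comm x y, ← sub_sub_sub_cancel_right y x j]
  exact abs_abs_sub_abs_le _ _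

lemma norm_sq_add_three_le (x y z : ℂ) :
    ‖x + y + z‖ ^ 2 ≤ 3 * (‖x‖ ^ 2 + ‖y‖ ^ 2 + ‖z‖ ^ 2) := by
  have h := norm_add₃_le (a := x) (b := y) (c := z)
  have h0 := norm_nonneg (x + y + z)
  nlinarith [sq_nonneg (‖x‖ - ‖y‖), sq_nonneg (‖y‖ - ‖z‖), sq_nonneg (‖x‖ - ‖z‖)]

set_option maxHeartbeats 1000000 in
/-- Approximate eigenvectors of a Jacobi operator can be cut down to windows on which a weight
inverse to the off-diagonal entries has large mass. -/
theorem exists_localized {b φ : ℤ → ℂ} {ω : ℤ → ℝ} (hω : ∀ n, 0 ≤ ω n)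
    (hbω : ∀ n, ‖b n‖ * ω n ≤ 1) {R : ℝ} (hR : 2 ≤ R) {M : ℕ}
    (hM : ∀ k : ℤ, 2 * R ≤ ∑ i ∈ Finset.range M, ω (k + i))
    (hφ : φ.support.Finite) (hφ0 : 0 < ∑' n, ‖φ n‖ ^ 2) {E : ℝ}
    (h : ∑' n, ‖jacobi b φ n - E * φ n‖ ^ 2 ≤ (1 / R) ^ 2 * ∑' n, ‖φ n‖ ^ 2) :
    ∃ (k : ℤ) (ψ : ℤ → ℂ), (∀ n, ψ n ≠ 0 → n ∈ Set.Ico k (k + M)) ∧ 0 < ∑' n, ‖ψ n‖ ^ 2 ∧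
      ∑' n, ‖jacobi b ψ n - E * ψ n‖ ^ 2 ≤ (18 / R) ^ 2 * ∑' n, ‖ψ n‖ ^ 2 := by
  obtain ⟨d, hd⟩ := exists_forall_add_one_eq ω
  have hR0 : 0 < R := by linarith
  set U : ℤ → ℝ := fun n => ‖φ n‖ ^ 2 with hU
  set G : ℤ → ℝ := fun n => ‖jacobi b φ n - E * φ n‖ ^ 2 with hG
  have hUs : Summable U := summable_norm_sq_of_finite_support hφ
  have hGs : Summable G := by
    refine summable_norm_sq_of_finite_support
      (((finite_support_jacobi (b := b) hφ).union hφ).subset fun n hn => ?_)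
    by_contra hcon
    simp only [Set.mem_union, Function.mem_support, not_or, not_not] at hcon
    exact hn (by simp [hcon.1, hcon.2])
  let χ : ℤ → ℤ → ℝ := fun j n => tent R j (d n)
  let ψ : ℤ → ℤ → ℂ := fun j n => χ j n * φ n
  have hψ : ∀ j, (ψ j).support.Finite := fun j =>
    hφ.subset fun n hn h => hn (by simp [ψ, h])
  let D : ℤ → ℤ → ℝ := fun j n => ‖b n‖ ^ 2 * (χ j (n + 1) - χ j n) ^ 2
  let J : Finset ℤ := hφ.toFinset.biUnion fun n => Finset.Icc ⌈d n - R / 2⌉ ⌊d n + R / 2⌋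
  have hpoint : ∀ j n, ‖jacobi b (ψ j) n - E * ψ j n‖ ^ 2 ≤
      3 * (χ j n ^ 2 * G n + D j n * U (n + 1) + D j (n - 1) * U (n - 1)) := by
    intro j n
    have e : jacobi b (ψ j) n - E * ψ j n = χ j n * (jacobi b φ n - E * φ n) +
        b n * ((χ j (n + 1) - χ j n : ℝ) : ℂ) * φ (n + 1) +
        star (b (n - 1)) * ((χ j (n - 1) - χ j n : ℝ) : ℂ) * φ (n - 1) := by
      simp only [jacobi, ψ]
      push_cast
      ring
    rw [e]
    refine (norm_sq_add_three_le _ _ _).trans_eq ?_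
    simp only [norm_mul, Complex.norm_real, norm_star, mul_pow, Real.norm_eq_abs, sq_abs, D, G, U,
      sub_add_cancel]
    ring
  have hD : ∀ n, ∑ j ∈ J, D j n ≤ 2 * (2 * R + 1) := by
    intro n
    have h1 : ∀ j ∈ J, D j n ≤ (if |d n - j| < R then 1 else 0) +
        if |d (n + 1) - j| < R then 1 else 0 := by
      intro j _
      have hle : D j n ≤ 1 := by
        have h2 : |χ j (n + 1) - χ j n| ≤ ω n := by
          refine (abs_tent_sub_le _ _ _ _).trans_eq ?_
          rw [hd, add_sub_cancel_left, abs_of_nonneg (hω n)]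
        have h3 : ‖b n‖ * |χ j (n + 1) - χ j n| ≤ 1 :=
          (mul_le_mul_of_nonneg_left h2 (norm_nonneg _)).trans (hbω n)
        calc D j n = (‖b n‖ * |χ j (n + 1) - χ j n|) ^ 2 := by rw [mul_pow, sq_abs]
          _ ≤ 1 := pow_le_one₀ (by positivity) h3
      by_cases ha : |d n - j| < R
      · rw [if_pos ha]
        split_ifs <;> linarith
      · by_cases hb : |d (n + 1) - j| < R
        · rw [if_pos hb, if_neg ha]
          linarith
        · simp [D, χ, tent_eq_zero ha, tent_eq_zero hb, ha, hb]
    refine (Finset.sum_le_sum h1).trans ?_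
    rw [Finset.sum_add_distrib, Finset.sum_boole, Finset.sum_boole]
    have := card_filter_abs_sub_lt_le J (d n) hR0.le
    have := card_filter_abs_sub_lt_le J (d (n + 1)) hR0.le
    linarith
  have hχ : ∀ n, ∑ j ∈ J, χ j n ^ 2 ≤ R ^ 2 * (2 * R + 1) := by
    intro n
    have h1 : ∀ j ∈ J, χ j n ^ 2 ≤ R ^ 2 * if |d n - j| < R then 1 else 0 := by
      intro j _
      by_cases ha : |d n - j| < R
      · rw [if_pos ha, mul_one]
        exact pow_le_pow_left₀ (tent_nonneg _ _ _) (tent_le hR0.le _ _) 2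
      · simp [χ, tent_eq_zero ha, ha]
    refine (Finset.sum_le_sum h1).trans ?_
    rw [← Finset.mul_sum, Finset.sum_boole]
    exact mul_le_mul_of_nonneg_left (card_filter_abs_sub_lt_le J (d n) hR0.le) (by positivity)
  have hχ' : ∀ n, φ n ≠ 0 → (R / 2) ^ 2 * (R - 1) ≤ ∑ j ∈ J, χ j n ^ 2 := by
    intro n hn
    have hsub : Finset.Icc ⌈d n - R / 2⌉ ⌊d n + R / 2⌋ ⊆ J :=
      Finset.subset_biUnion_of_mem (fun n => Finset.Icc ⌈d n - R / 2⌉ ⌊d n + R / 2⌋)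
        (by simpa using hn)
    refine le_trans ?_ (Finset.sum_le_sum_of_subset_of_nonneg hsub fun _ _ _ => sq_nonneg _)
    refine le_trans ?_ (Finset.card_nsmul_le_sum _ _ ((R / 2) ^ 2) fun j hj => ?_)
    · rw [nsmul_eq_mul, mul_comm]
      exact mul_le_mul_of_nonneg_right (le_card_Icc_ceil_floor _ _) (by positivity)
    · rw [Finset.mem_Icc, Int.ceil_le, Int.le_floor] at hj
      refine pow_le_pow_left₀ (by positivity) (le_trans ?_ (le_max_right _ _)) 2
      have : |d n - j| ≤ R / 2 := abs_le.mpr ⟨by linarith [hj.2], by linarith [hj.1]⟩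
      linarith
  have hUp : ∑' n, U (n + 1) = ∑' n, U n := (Equiv.addRight (1 : ℤ)).tsum_eq U
  have hUm : ∑' n, U (n - 1) = ∑' n, U n := (Equiv.subRight (1 : ℤ)).tsum_eq U
  have hUps : Summable fun n => U (n + 1) := (Equiv.addRight (1 : ℤ)).summable_iff.mpr hUs
  have hUms : Summable fun n => U (n - 1) := (Equiv.subRight (1 : ℤ)).summable_iff.mpr hUs
  have hQs : ∀ j, Summable fun n => ‖jacobi b (ψ j) n - E * ψ j n‖ ^ 2 := fun j => by
    refine summable_norm_sq_of_finite_support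
      (((finite_support_jacobi (b := b) (hψ j)).union (hψ j)).subset fun n hn => ?_)
    by_contra hcon
    simp only [Set.mem_union, Function.mem_support, not_or, not_not] at hcon
    exact hn (by simp [hcon.1, hcon.2])
  have hQ : ∑ j ∈ J, ∑' n, ‖jacobi b (ψ j) n - E * ψ j n‖ ^ 2 ≤
      15 * (2 * R + 1) * ∑' n, U n := by
    rw [← Summable.tsum_finsetSum fun j _ => hQs j]
    have hle : ∀ n, ∑ j ∈ J, ‖jacobi b (ψ j) n - E * ψ j n‖ ^ 2 ≤
        3 * (R ^ 2 * (2 * R + 1)) * G n + 3 * (2 * (2 * R + 1)) * U (n + 1) +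
          3 * (2 * (2 * R + 1)) * U (n - 1) := by
      intro n
      refine (Finset.sum_le_sum fun j _ => hpoint j n).trans ?_
      rw [← Finset.mul_sum, Finset.sum_add_distrib, Finset.sum_add_distrib, ← Finset.sum_mul,
        ← Finset.sum_mul, ← Finset.sum_mul]
      have h1 := mul_le_mul_of_nonneg_right (hχ n) (show 0 ≤ G n by positivity)
      have h2 := mul_le_mul_of_nonneg_right (hD n) (show 0 ≤ U (n + 1) by positivity)
      have h3 := mul_le_mul_of_nonneg_right (hD (n - 1)) (show 0 ≤ U (n - 1) by positivity)
      linarith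
    have hs := ((hGs.mul_left (3 * (R ^ 2 * (2 * R + 1)))).add
      (hUps.mul_left (3 * (2 * (2 * R + 1))))).add (hUms.mul_left (3 * (2 * (2 * R + 1))))
    refine (Summable.tsum_le_tsum hle (summable_sum fun j _ => hQs j) hs).trans ?_
    rw [((hGs.mul_left _).add (hUps.mul_left _)).tsum_add (hUms.mul_left _),
      (hGs.mul_left _).tsum_add (hUps.mul_left _), tsum_mul_left, tsum_mul_left, tsum_mul_left,
      hUp, hUm]
    have h1 := mul_le_mul_of_nonneg_left h (show 0 ≤ 3 * (R ^ 2 * (2 * R + 1)) by positivity)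
    have h2 : 3 * (R ^ 2 * (2 * R + 1)) * ((1 / R) ^ 2 * ∑' n, U n) =
        3 * (2 * R + 1) * ∑' n, U n := by
      field_simp
    linarith
  have hPn : ∀ j n, ‖ψ j n‖ ^ 2 = χ j n ^ 2 * U n := fun j n => by
    simp [ψ, mul_pow, U]
  have hP : (R / 2) ^ 2 * (R - 1) * ∑' n, U n ≤ ∑ j ∈ J, ∑' n, ‖ψ j n‖ ^ 2 := by
    rw [← Summable.tsum_finsetSum fun j _ => summable_norm_sq_of_finite_support (hψ j),
      ← tsum_mul_left]
    refine Summable.tsum_le_tsum (fun n => ?_) (hUs.mul_left _)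
      (summable_sum fun j _ => summable_norm_sq_of_finite_support (hψ j))
    simp only [hPn]
    rw [← Finset.sum_mul]
    by_cases hn : φ n = 0
    · simp [U, hn]
    · exact mul_le_mul_of_nonneg_right (hχ' n hn) (by positivity)
  have hPpos : 0 < (R / 2) ^ 2 * (R - 1) * ∑' n, U n := by
    have : 0 < R - 1 := by linarith
    positivity
  obtain ⟨j, -, hj0, hj⟩ := exists_pos_le_mul_of_sum_le (s := J) (c := (18 / R) ^ 2)
    (P := fun j => ∑' n, ‖ψ j n‖ ^ 2) (Q := fun j => ∑' n, ‖jacobi b (ψ j) n - E * ψ j n‖ ^ 2)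
    (fun _ _ => tsum_nonneg fun _ => by positivity) (fun _ _ => tsum_nonneg fun _ => by positivity)
    (hPpos.trans_le hP) (by
      refine hQ.trans (le_trans ?_ (mul_le_mul_of_nonneg_left hP (by positivity)))
      rw [← mul_assoc]
      refine mul_le_mul_of_nonneg_right ?_ hφ0.le
      have : (18 / R) ^ 2 * ((R / 2) ^ 2 * (R - 1)) = 81 * (R - 1) := by
        field_simp
        ring
      rw [this]
      linarith)
  have hsupp : ∀ n, ψ j n ≠ 0 → |d n - j| < R := fun n hn => by
    by_contra h
    exact hn (by simp [ψ, χ, tent_eq_zero h])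
  have hmono : Monotone d := monotone_int_of_le_succ fun n => by rw [hd]; linarith [hω n]
  have hne : ((hψ j).toFinset).Nonempty := by
    by_contra hcon
    rw [Finset.not_nonempty_iff_eq_empty, Set.Finite.toFinset_eq_empty,
      Function.support_eq_empty_iff] at hcon
    simp [hcon] at hj0
  refine ⟨(hψ j).toFinset.min' hne, ψ j, fun n hn => ⟨Finset.min'_le _ _ (by simpa using hn), ?_⟩,
    hj0, hj⟩
  by_contra! hcon
  have hk := hsupp _ (by simpa using Finset.min'_mem _ hne)
  have hn' := hsupp n hn
  rw [abs_lt] at hk hn'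
  have h1 := hM ((hψ j).toFinset.min' hne)
  rw [sum_Ico_eq_sub hd] at h1
  have h2 := hmono hcon
  linarith

end Localization

section ZeroMeasure

/-- The off-diagonal entries of the critical almost Mathieu operator in the chiral gauge. -/
noncomputable def chiralBond (μ : ℝ) (ζ : ℂ) (n : ℤ) : ℂ :=
  1 + Complex.exp (Complex.I * ((2 * π * (μ * n) : ℝ) : ℂ)) * ζ

lemma exp_two_pi_mul_sub_int (z : ℝ) (m : ℤ) :
    Complex.exp (Complex.I * ((2 * π * (z - m) : ℝ) : ℂ)) =
      Complex.exp (Complex.I * ((2 * π * z : ℝ) : ℂ)) := by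
  rw [Complex.exp_eq_exp_iff_exists_int]
  exact ⟨-m, by push_cast; ring⟩

lemma norm_exp_two_pi_sub_one_le (z : ℝ) (m : ℤ) :
    ‖Complex.exp (Complex.I * ((2 * π * z : ℝ) : ℂ)) - 1‖ ≤ 2 * π * |z - m| := by
  rw [← exp_two_pi_mul_sub_int z m]
  refine Real.norm_exp_I_mul_ofReal_sub_one_le.trans_eq ?_
  rw [norm_mul, Real.norm_of_nonneg (by positivity), Real.norm_eq_abs]

/-- Over a window whose length is the denominator of a good rational approximant, the reciprocals
of the off-diagonal entries have logarithmically enhanced mass. -/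
lemma le_sum_inv_norm_chiralBond {μ : ℝ} {r : ℚ} (hr : |μ - r| ≤ 1 / (r.den : ℝ) ^ 2) {ζ : ℂ}
    (hζ : ‖ζ‖ = 1) (k : ℤ) :
    r.den * (∑ j ∈ Finset.range r.den, 1 / ((j : ℝ) + 2)) / (2 * π) ≤
      ∑ i ∈ Finset.range r.den, 1 / max ‖chiralBond μ ζ (k + i)‖ (1 / r.den) := by
  set M := r.den with hM
  have hM0 : (0 : ℝ) < M := Nat.cast_pos.mpr r.den_pos
  have hMz : (0 : ℤ) < M := Nat.cast_pos.mpr r.den_pos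
  set y : ℝ := Complex.arg (-ζ) / (2 * π) with hy
  have hζy : ζ = -Complex.exp (Complex.I * ((2 * π * y : ℝ) : ℂ)) := by
    have h := Complex.norm_mul_exp_arg_mul_I (-ζ)
    rw [norm_neg, hζ, Complex.ofReal_one, one_mul] at h
    rw [hy, mul_div_cancel₀ _ (by positivity), mul_comm, h, neg_neg]
  have hbond : ∀ n : ℤ, ‖chiralBond μ ζ n‖ =
      ‖Complex.exp (Complex.I * ((2 * π * (μ * n + y) : ℝ) : ℂ)) - 1‖ := by
    intro n
    rw [chiralBond, hζy, norm_sub_rev, mul_neg, ← Complex.exp_add, sub_eq_add_neg]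
    congr 4
    push_cast
    ring
  set c : ℝ := (μ * k + y) * M with hc
  let ρ : ℕ → ℕ := fun i => ((⌊c⌋ + r.num * i) % M).toNat
  have hρ : ∀ i, ((ρ i : ℕ) : ℤ) = (⌊c⌋ + r.num * i) % M := fun i =>
    Int.toNat_of_nonneg (Int.emod_nonneg _ hMz.ne')
  have hρlt : ∀ i, ρ i < M := fun i => by
    have := Int.emod_lt_of_pos (⌊c⌋ + r.num * i) hMz
    rw [← hρ] at this
    exact_mod_cast this
  have hinj : Set.InjOn ρ (Finset.range M : Set ℕ) := by
    intro i hi j hj hij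
    have h1 : (⌊c⌋ + r.num * i) % M = (⌊c⌋ + r.num * j) % M := by rw [← hρ, ← hρ, hij]
    have h3 : (M : ℤ) ∣ r.num * ((i : ℤ) - j) := by
      have h4 := Int.dvd_of_emod_eq_zero (Int.emod_eq_emod_iff_emod_sub_eq_zero.mp h1)
      have h5 : ⌊c⌋ + r.num * i - (⌊c⌋ + r.num * j) = r.num * ((i : ℤ) - j) := by ring
      rwa [h5] at h4
    have hcop : IsCoprime (M : ℤ) r.num := by
      rw [Int.isCoprime_iff_nat_coprime, Int.natAbs_natCast]
      exact r.reduced.symm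
    have h6 := hcop.dvd_of_dvd_mul_left h3
    have hi' := Finset.mem_range.mp hi
    have hj' := Finset.mem_range.mp hj
    have := Int.eq_zero_of_abs_lt_dvd h6 (by rw [abs_lt]; lia)
    lia
  have himage : (Finset.range M).image ρ = Finset.range M := by
    refine Finset.eq_of_subset_of_card_le (fun j hj => ?_) ?_
    · obtain ⟨i, -, rfl⟩ := Finset.mem_image.mp hj
      exact Finset.mem_range.mpr (hρlt i)
    · rw [Finset.card_image_of_injOn hinj]
  have hnorm : ∀ i ∈ Finset.range M,
      max ‖chiralBond μ ζ (k + i)‖ (1 / M) ≤ 2 * π * ((ρ i + 2) / M) := by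
    intro i hi
    have hi' : (i : ℝ) < M := Nat.cast_lt.mpr (Finset.mem_range.mp hi)
    refine max_le ?_ ?_
    · rw [hbond]
      refine (norm_exp_two_pi_sub_one_le _ ((⌊c⌋ + r.num * i) / M)).trans ?_
      refine mul_le_mul_of_nonneg_left ?_ (by positivity)
      have hdm : ((M * ((⌊c⌋ + r.num * i) / M) + (ρ i : ℤ) : ℤ) : ℝ) = (⌊c⌋ + r.num * i : ℤ) := by
        rw [hρ, Int.mul_ediv_add_emod]
      push_cast at hdm
      have hrM : (r : ℝ) * M = r.num := by
        exact_mod_cast Rat.mul_den_eq_num r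
      have e : μ * ((k + i : ℤ) : ℝ) + y - (((⌊c⌋ + r.num * i) / M : ℤ) : ℝ) =
          (ρ i + Int.fract c) / M + (μ - r) * i := by
        rw [← add_left_inj ((((⌊c⌋ + r.num * i) / M : ℤ) : ℝ)), sub_add_cancel, eq_comm,
          ← mul_left_inj' hM0.ne']
        have hfr : c = ⌊c⌋ + Int.fract c := (Int.floor_add_fract c).symm
        rw [hc] at hfr
        rw [add_mul, add_mul, div_mul_cancel₀ _ hM0.ne']
        push_cast
        linear_combination hdm - hfr - i * hrM
      rw [e]
      have h1 : |(ρ i + Int.fract c) / M| ≤ (ρ i + 1) / M := by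
        rw [abs_of_nonneg (by have := Int.fract_nonneg c; positivity)]
        gcongr
        exact (Int.fract_lt_one c).le
      have h2 : |(μ - r) * i| ≤ 1 / M := by
        rw [abs_mul, abs_of_nonneg (Nat.cast_nonneg i : (0 : ℝ) ≤ i)]
        calc |μ - r| * i ≤ 1 / (M : ℝ) ^ 2 * M := by gcongr
          _ = 1 / M := by field_simp
      calc _ ≤ (ρ i + 1) / (M : ℝ) + 1 / M := (abs_add_le _ _).trans (add_le_add h1 h2)
        _ = _ := by ring
    · rw [← mul_div_assoc]
      gcongr
      have : (0 : ℝ) ≤ ρ i := Nat.cast_nonneg _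
      nlinarith [Real.pi_gt_three]
  calc M * (∑ j ∈ Finset.range M, 1 / ((j : ℝ) + 2)) / (2 * π)
      = ∑ j ∈ Finset.range M, 1 / (2 * π * (((j : ℕ) + 2) / M)) := by
        rw [Finset.mul_sum, Finset.sum_div]
        refine Finset.sum_congr rfl fun j _ => ?_
        field_simp
    _ = ∑ i ∈ Finset.range M, 1 / (2 * π * ((ρ i + 2) / M)) := by
        conv_lhs => rw [← himage]
        rw [Finset.sum_image hinj]
    _ ≤ _ := Finset.sum_le_sum fun i hi => by
        refine one_div_le_one_div_of_le ?_ (hnorm i hi)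
        exact lt_max_of_lt_right (by positivity)

lemma Irrational.exists_forall_lt_den {μ : ℝ} (hμ : Irrational μ) (B : ℕ) :
    ∃ n₀ : ℕ, ∀ n ≥ n₀, ∀ r : ℚ, |μ - r| ≤ 1 / ((n + 1 : ℝ) * r.den) → B < r.den := by
  have hpos : ∀ d : ℕ, 1 ≤ d → 0 < |d * μ - round (d * μ)| := by
    intro d hd
    rw [abs_pos, sub_ne_zero]
    exact (hμ.natCast_mul (by lia)).ne_int _
  obtain ⟨c, hc, hle⟩ : ∃ c > 0, ∀ d ∈ Finset.Icc 1 B, c ≤ |d * μ - round (d * μ)| := by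
    induction B with
    | zero => exact ⟨1, one_pos, by simp⟩
    | succ B ih =>
      obtain ⟨c, hc, hle⟩ := ih
      refine ⟨min c |(B + 1 : ℕ) * μ - round ((B + 1 : ℕ) * μ)|,
        lt_min hc (hpos _ (by lia)), fun d hd => ?_⟩
      rw [Finset.mem_Icc] at hd
      rcases hd.2.lt_or_eq with h | rfl
      · exact (min_le_left _ _).trans (hle d (Finset.mem_Icc.mpr ⟨hd.1, by lia⟩))
      · exact min_le_right _ _
  obtain ⟨n₀, hn₀⟩ := exists_nat_gt (1 / c)
  refine ⟨n₀, fun n hn r hr => ?_⟩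
  by_contra! hcon
  have hd0 : (0 : ℝ) < r.den := Nat.cast_pos.mpr r.den_pos
  have h1 := hle r.den (Finset.mem_Icc.mpr ⟨r.den_pos, hcon⟩)
  have h2 : |r.den * μ - round (r.den * μ)| ≤ |r.den * μ - r.num| := round_le _ _
  have h3 : |r.den * μ - r.num| ≤ 1 / (n + 1 : ℝ) := by
    have hrM : (r : ℝ) * r.den = r.num := by exact_mod_cast Rat.mul_den_eq_num r
    have : r.den * μ - r.num = r.den * (μ - r) := by linear_combination hrM
    rw [this, abs_mul, abs_of_pos hd0]
    calc r.den * |μ - r| ≤ r.den * (1 / ((n + 1 : ℝ) * r.den)) := by gcongr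
      _ = _ := by field_simp
  have h4 : 1 / (n + 1 : ℝ) < c := by
    rw [div_lt_comm₀ (by positivity) hc]
    have : (n₀ : ℝ) ≤ n := by exact_mod_cast hn
    linarith
  linarith

lemma stdAddChar_num_mul (r : ℚ) [NeZero r.den] (n : ℤ) :
    ZMod.stdAddChar ((r.num : ZMod r.den) * (n : ZMod r.den)) =
      Complex.exp (Complex.I * ((2 * π * (r * n) : ℝ) : ℂ)) := by
  rw [← Int.cast_mul, ZMod.stdAddChar_coe]
  congr 1
  have : ((r : ℝ) : ℂ) = (r.num : ℂ) / (r.den : ℂ) := by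
    rw [Complex.ofReal_ratCast]
    exact Rat.cast_def r
  push_cast at this ⊢
  rw [this]
  ring

lemma norm_sq_add_le (x y : ℂ) : ‖x + y‖ ^ 2 ≤ 2 * ‖x‖ ^ 2 + 2 * ‖y‖ ^ 2 := by
  have h := norm_add_le x y
  have h0 := norm_nonneg (x + y)
  nlinarith [sq_nonneg (‖x‖ - ‖y‖)]

set_option maxHeartbeats 1000000 in
/-- Replacing the frequency by a rational one on a short window. -/
lemma tsum_jacobi_sub_le {b b' ψ : ℤ → ℂ} (hψ : ψ.support.Finite) {e E : ℝ}
    (hup : ∀ n, ψ (n + 1) ≠ 0 → ‖b' n - b n‖ ≤ e) (hdown : ∀ n, ψ n ≠ 0 → ‖b' n - b n‖ ≤ e)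
    {c : ℝ} (h : ∑' n, ‖jacobi b ψ n - E * ψ n‖ ^ 2 ≤ c * ∑' n, ‖ψ n‖ ^ 2) :
    ∑' n, ‖jacobi b' ψ n - E * ψ n‖ ^ 2 ≤ (2 * c + 8 * e ^ 2) * ∑' n, ‖ψ n‖ ^ 2 := by
  set U : ℤ → ℝ := fun n => ‖ψ n‖ ^ 2 with hU
  have hUs : Summable U := summable_norm_sq_of_finite_support hψ
  have hUp : ∑' n, U (n + 1) = ∑' n, U n := (Equiv.addRight (1 : ℤ)).tsum_eq U
  have hUm : ∑' n, U (n - 1) = ∑' n, U n := (Equiv.subRight (1 : ℤ)).tsum_eq U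
  have hUps : Summable fun n => U (n + 1) := (Equiv.addRight (1 : ℤ)).summable_iff.mpr hUs
  have hUms : Summable fun n => U (n - 1) := (Equiv.subRight (1 : ℤ)).summable_iff.mpr hUs
  have hs : ∀ b : ℤ → ℂ, Summable fun n => ‖jacobi b ψ n - E * ψ n‖ ^ 2 := fun b => by
    refine summable_norm_sq_of_finite_support
      (((finite_support_jacobi (b := b) hψ).union hψ).subset fun n hn => ?_)
    by_contra hcon
    simp only [Set.mem_union, Function.mem_support, not_or, not_not] at hcon
    exact hn (by simp [hcon.1, hcon.2])
  have hmul : ∀ (x z : ℂ), (z ≠ 0 → ‖x‖ ≤ e) → ‖x * z‖ ^ 2 ≤ e ^ 2 * ‖z‖ ^ 2 := by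
    intro x z hx
    rw [norm_mul, mul_pow]
    by_cases hz : z = 0
    · simp [hz]
    · exact mul_le_mul_of_nonneg_right (pow_le_pow_left₀ (norm_nonneg _) (hx hz) 2) (by positivity)
  have hpoint : ∀ n, ‖jacobi b' ψ n - E * ψ n‖ ^ 2 ≤
      2 * ‖jacobi b ψ n - E * ψ n‖ ^ 2 + 4 * e ^ 2 * U (n + 1) + 4 * e ^ 2 * U (n - 1) := by
    intro n
    have heq : jacobi b' ψ n - E * ψ n = (jacobi b ψ n - E * ψ n) +
        ((b' n - b n) * ψ (n + 1) + star (b' (n - 1) - b (n - 1)) * ψ (n - 1)) := by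
      simp only [jacobi, star_sub]
      ring
    rw [heq]
    have h1 := norm_sq_add_le (jacobi b ψ n - E * ψ n)
      ((b' n - b n) * ψ (n + 1) + star (b' (n - 1) - b (n - 1)) * ψ (n - 1))
    have h2 := norm_sq_add_le ((b' n - b n) * ψ (n + 1))
      (star (b' (n - 1) - b (n - 1)) * ψ (n - 1))
    have h3 := hmul _ _ (hup n)
    have h4 := hmul (star (b' (n - 1) - b (n - 1))) (ψ (n - 1))
      (fun hz => by rw [norm_star]; exact hdown _ hz)
    simp only [hU]
    linarith
  have hsr := (((hs b).mul_left 2).add (hUps.mul_left (4 * e ^ 2))).add (hUms.mul_left (4 * e ^ 2))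
  refine (Summable.tsum_le_tsum hpoint (hs b') hsr).trans ?_
  rw [(((hs b).mul_left 2).add (hUps.mul_left _)).tsum_add (hUms.mul_left _),
    ((hs b).mul_left 2).tsum_add (hUps.mul_left _), tsum_mul_left, tsum_mul_left, tsum_mul_left,
    hUp, hUm]
  linarith

end ZeroMeasure

section ZeroMeasureCovering

lemma norm_stdAddChar_sub_chiralBond_le (μ : ℝ) (r : ℚ) [NeZero r.den] {ζ : ℂ} (hζ : ‖ζ‖ = 1)
    (k n : ℤ) :
    ‖(1 + ZMod.stdAddChar ((r.num : ZMod r.den) * (n : ZMod r.den)) *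
        (Complex.exp (Complex.I * ((2 * π * ((μ - r) * k) : ℝ) : ℂ)) * ζ)) - chiralBond μ ζ n‖ ≤
      2 * π * |μ - r| * |(n : ℝ) - k| := by
  rw [stdAddChar_num_mul, chiralBond]
  have h : (1 + Complex.exp (Complex.I * ((2 * π * (r * n) : ℝ) : ℂ)) *
      (Complex.exp (Complex.I * ((2 * π * ((μ - r) * k) : ℝ) : ℂ)) * ζ)) -
      (1 + Complex.exp (Complex.I * ((2 * π * (μ * n) : ℝ) : ℂ)) * ζ) =
      Complex.exp (Complex.I * ((2 * π * (μ * n) : ℝ) : ℂ)) * ζ *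
        (Complex.exp (Complex.I * ((2 * π * ((μ - r) * (k - n)) : ℝ) : ℂ)) - 1) := by
    have h2 : Complex.exp (Complex.I * ((2 * π * (r * n) : ℝ) : ℂ)) *
        Complex.exp (Complex.I * ((2 * π * ((μ - r) * k) : ℝ) : ℂ)) =
        Complex.exp (Complex.I * ((2 * π * (μ * n) : ℝ) : ℂ)) *
        Complex.exp (Complex.I * ((2 * π * ((μ - r) * (k - n)) : ℝ) : ℂ)) := by
      rw [← Complex.exp_add, ← Complex.exp_add]
      congr 1
      push_cast
      ring
    linear_combination ζ * h2
  rw [h, norm_mul, norm_mul, hζ, Complex.norm_exp_I_mul_ofReal, one_mul, one_mul]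
  refine Real.norm_exp_I_mul_ofReal_sub_one_le.trans_eq ?_
  rw [norm_mul, Real.norm_of_nonneg (by positivity), Real.norm_eq_abs, abs_mul,
    abs_sub_comm (k : ℝ), mul_assoc (2 * π)]

/-- Two successive rational approximations of the frequency give a cover of the set of
approximate eigenvalues by few short intervals. -/
lemma volume_le_of_rat_approx {μ : ℝ} {S : Set ℝ}
    (hS : ∀ E ∈ S, ∀ δ > 0, ∃ ζ : ℂ, ‖ζ‖ = 1 ∧ ∃ φ : ℤ → ℂ, φ.support.Finite ∧
      0 < ∑' n, ‖φ n‖ ^ 2 ∧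
      ∑' n, ‖jacobi (chiralBond μ ζ) φ n - E * φ n‖ ^ 2 ≤ δ ^ 2 * ∑' n, ‖φ n‖ ^ 2)
    {r s : ℚ} {K : ℕ} (hK : 1 ≤ K) (hr : |μ - r| ≤ 1 / (r.den : ℝ) ^ 2)
    (hs : |μ - s| ≤ 1 / ((((K * r.den : ℕ) : ℝ) + 1) * s.den)) (hq : 3 ≤ s.den)
    {R : ℝ} (hR : 2 ≤ R)
    (hRT : 2 * R ≤ r.den * (∑ j ∈ Finset.range r.den, 1 / ((j : ℝ) + 2)) / (2 * π)) :
    volume S ≤ ENNReal.ofReal (8 * π / s.den + 2 * s.den * (26 / R + 20 / (K * s.den))) := by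
  have : NeZero s.den := ⟨s.den_ne_zero⟩
  have hM0 : (0 : ℝ) < r.den := Nat.cast_pos.mpr r.den_pos
  have hq0 : (0 : ℝ) < s.den := Nat.cast_pos.mpr s.den_pos
  have hK0 : (0 : ℝ) < K := Nat.cast_pos.mpr hK
  have hR0 : 0 < R := by linarith
  set η : ℝ := 26 / R + 20 / (K * s.den) with hη
  have hη0 : 0 < η := by positivity
  have hunit : IsUnit (s.num : ZMod s.den) := by
    rw [ZMod.coe_int_isUnit_iff_isCoprime, Int.isCoprime_iff_nat_coprime, Int.natAbs_natCast]
    exact s.reduced.symm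
  obtain ⟨lo, hi, hle, hsum, hmem⟩ := exists_bands_approx hq hunit
  have hcover : S ⊆ ⋃ i, Set.Icc (lo i - η) (hi i + η) := by
    intro E hE
    obtain ⟨ζ, hζ, φ, hφ, hφ0, hφE⟩ := hS E hE (1 / R) (by positivity)
    obtain ⟨k, ψ, hψ, hψ0, hψE⟩ := exists_localized
      (ω := fun n => 1 / max ‖chiralBond μ ζ n‖ (1 / r.den)) (M := r.den)
      (fun n => by positivity)
      (fun n => by
        have hpos : 0 < max ‖chiralBond μ ζ n‖ (1 / (r.den : ℝ)) :=
          lt_max_of_lt_right (by positivity)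
        rw [mul_one_div, div_le_one hpos]
        exact le_max_left _ _) hR
      (fun k => hRT.trans (le_sum_inv_norm_chiralBond hr hζ k)) hφ hφ0 hφE
    have hψs : ψ.support.Finite := (Set.finite_Ico k (k + r.den)).subset fun n hn => hψ n hn
    set ζ' := Complex.exp (Complex.I * ((2 * π * ((μ - s) * k) : ℝ) : ℂ)) * ζ with hζ'
    have hdist : ∀ n : ℤ, |(n : ℝ) - k| ≤ r.den →
        ‖(1 + ZMod.stdAddChar ((s.num : ZMod s.den) * (n : ZMod s.den)) * ζ') -
          chiralBond μ ζ n‖ ≤ 2 * π / (K * s.den) := by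
      intro n hn
      refine (norm_stdAddChar_sub_chiralBond_le μ s hζ k n).trans ?_
      calc 2 * π * |μ - s| * |(n : ℝ) - k|
          ≤ 2 * π * (1 / ((((K * r.den : ℕ) : ℝ) + 1) * s.den)) * r.den := by gcongr
        _ ≤ 2 * π * (1 / ((K * r.den) * s.den)) * r.den := by
            gcongr
            push_cast
            linarith
        _ = _ := by field_simp
    have hmove := tsum_jacobi_sub_le (b' := fun n : ℤ =>
      1 + ZMod.stdAddChar ((s.num : ZMod s.den) * (n : ZMod s.den)) * ζ') hψs
      (fun n hn => hdist n (by
        have h1 := hψ _ hn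
        have h2 : |n - k| ≤ (r.den : ℤ) := by
          have := r.den_pos
          rw [abs_le]
          constructor <;> linarith [h1.1, h1.2]
        exact_mod_cast h2))
      (fun n hn => hdist n (by
        have h1 := hψ _ hn
        have h2 : |n - k| ≤ (r.den : ℤ) := by
          rw [abs_le]
          constructor <;> linarith [h1.1, h1.2]
        exact_mod_cast h2)) hψE
    have hconst : 2 * (18 / R) ^ 2 + 8 * (2 * π / (K * s.den)) ^ 2 ≤ η ^ 2 := by
      have hx : 0 < 1 / R := by positivity
      have hy : 0 < 1 / (K * (s.den : ℝ)) := by positivity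
      have e1 : 18 / R = 18 * (1 / R) := by ring
      have e2 : 2 * π / (K * s.den) = 2 * π * (1 / (K * (s.den : ℝ))) := by ring
      have e3 : η = 26 * (1 / R) + 20 * (1 / (K * (s.den : ℝ))) := by rw [hη]; ring
      rw [e1, e2, e3]
      have hπ : π ^ 2 ≤ 10 := by nlinarith [Real.pi_lt_d2, Real.pi_gt_three]
      have := mul_le_mul_of_nonneg_right hπ (sq_nonneg (1 / (K * (s.den : ℝ))))
      nlinarith [mul_pos hx hy, sq_nonneg (1 / R), sq_nonneg (1 / (K * (s.den : ℝ)))]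
    have hζ'n : ‖ζ'‖ = 1 := by
      rw [hζ', norm_mul, hζ, Complex.norm_exp_I_mul_ofReal, one_mul]
    obtain ⟨i, hi⟩ := hmem ζ' hζ'n ψ hψs hψ0 E η hη0.le
      (hmove.trans (mul_le_mul_of_nonneg_right hconst hψ0.le))
    exact Set.mem_iUnion.mpr ⟨i, hi⟩
  calc volume S ≤ ∑ i, volume (Set.Icc (lo i - η) (hi i + η)) :=
        (measure_mono hcover).trans (measure_iUnion_fintype_le _ _)
    _ = ∑ i, ENNReal.ofReal (hi i - lo i + 2 * η) := by
        refine Finset.sum_congr rfl fun i _ => ?_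
        rw [Real.volume_Icc]
        congr 1
        ring
    _ = ENNReal.ofReal (∑ i, (hi i - lo i + 2 * η)) :=
        (ENNReal.ofReal_sum_of_nonneg fun i _ => by linarith [hle i]).symm
    _ ≤ _ := by
        refine ENNReal.ofReal_le_ofReal ?_
        rw [Finset.sum_add_distrib, Finset.sum_const, Finset.card_univ, ZMod.card, nsmul_eq_mul]
        linarith

/-- The set of approximate eigenvalues of the chiral operators has measure zero. -/
theorem volume_eq_zero_of_chiral_approx {μ : ℝ} (hμ : Irrational μ) {S : Set ℝ}
    (hS : ∀ E ∈ S, ∀ δ > 0, ∃ ζ : ℂ, ‖ζ‖ = 1 ∧ ∃ φ : ℤ → ℂ, φ.support.Finite ∧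
      0 < ∑' n, ‖φ n‖ ^ 2 ∧
      ∑' n, ‖jacobi (chiralBond μ ζ) φ n - E * φ n‖ ^ 2 ≤ δ ^ 2 * ∑' n, ‖φ n‖ ^ 2) :
    volume S = 0 := by
  refine le_antisymm (ENNReal.le_of_forall_pos_le_add fun ε hε _ => ?_) zero_le
  rw [zero_add]
  set d : ℝ := (ε : ℝ) / 3 with hd
  have hd0 : 0 < d := by positivity
  obtain ⟨K, hK⟩ := exists_nat_gt (40 / d)
  have hK0 : (0 : ℝ) < K := lt_trans (by positivity) hK
  have hK1 : 1 ≤ K := Nat.cast_pos.mp hK0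
  obtain ⟨Q, hQ⟩ := exists_nat_gt (8 * π / d)
  obtain ⟨n₀, hn₀⟩ := hμ.exists_forall_lt_den (max 2 Q)
  have hT : Tendsto (fun M => ∑ j ∈ Finset.range M, 1 / ((j : ℝ) + 2)) atTop atTop := by
    have h := (tendsto_atTop_add_const_right atTop (-1 : ℝ)
      ((tendsto_add_atTop_iff_nat 1).mpr Real.tendsto_sum_range_one_div_nat_succ_atTop))
    refine h.congr fun M => ?_
    rw [Finset.sum_range_succ']
    push_cast
    norm_num [add_assoc]
  obtain ⟨M₀, hM₀⟩ :=
    (hT.eventually_ge_atTop (max (8 * π) (208 * π * K / d))).exists_forall_of_atTop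
  obtain ⟨n₁, hn₁⟩ := hμ.exists_forall_lt_den (max n₀ M₀)
  obtain ⟨r, hr, hrn⟩ := Real.exists_rat_abs_sub_le_and_den_le μ (n := n₁ + 1) (by lia)
  have hrden := hn₁ (n₁ + 1) (by lia) r hr
  obtain ⟨s, hs, hsn⟩ := Real.exists_rat_abs_sub_le_and_den_le μ (n := K * r.den)
    (Nat.mul_pos hK1 r.den_pos)
  have hsden := hn₀ (K * r.den) (by nlinarith [le_max_left n₀ M₀]) s hs
  set T := ∑ j ∈ Finset.range r.den, 1 / ((j : ℝ) + 2) with hTdef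
  have hTle := hM₀ r.den (by lia)
  have hT1 : 8 * π ≤ T := (le_max_left _ _).trans hTle
  have hT2 : 208 * π * K / d ≤ T := (le_max_right _ _).trans hTle
  have hT0 : 0 < T := lt_of_lt_of_le (by positivity) hT1
  have hM0 : (1 : ℝ) ≤ r.den := Nat.one_le_cast.mpr r.den_pos
  have hq0 : (0 : ℝ) < s.den := Nat.cast_pos.mpr s.den_pos
  have hR : 2 ≤ r.den * T / (4 * π) := by
    rw [le_div_iff₀ (by positivity)]
    nlinarith
  have hrsq : |μ - r| ≤ 1 / (r.den : ℝ) ^ 2 := by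
    refine hr.trans ?_
    have : (r.den : ℝ) ≤ (n₁ + 1 : ℕ) := by exact_mod_cast hrn
    rw [sq]
    gcongr
    linarith
  refine (volume_le_of_rat_approx hS hK1 hrsq hs (by lia) hR (le_of_eq (by ring))).trans ?_
  rw [← ENNReal.ofReal_coe_nnreal]
  refine ENNReal.ofReal_le_ofReal ?_
  have hQs : (Q : ℝ) ≤ s.den := by exact_mod_cast (by lia : Q ≤ s.den)
  have h1 : 8 * π / s.den ≤ d := by
    rw [div_le_iff₀ hq0]
    rw [div_lt_iff₀ hd0] at hQ
    nlinarith
  have h2 : 2 * s.den * (26 / (r.den * T / (4 * π))) ≤ d := by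
    have hsK : (s.den : ℝ) ≤ K * r.den := by exact_mod_cast hsn
    calc 2 * s.den * (26 / (r.den * T / (4 * π)))
        ≤ 2 * (K * r.den) * (26 / (r.den * T / (4 * π))) := by gcongr
      _ = 208 * π * K / T := by
          field_simp
          ring
      _ ≤ d := by
          rw [div_le_iff₀ hT0]
          rw [div_le_iff₀ hd0] at hT2
          linarith
  have h3 : 2 * s.den * (20 / (K * s.den)) ≤ d := by
    have : 2 * s.den * (20 / (K * s.den)) = 40 / (K : ℝ) := by
      field_simp
      ring
    rw [this, div_le_iff₀ hK0]
    rw [div_lt_iff₀ hd0] at hK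
    linarith
  rw [mul_add]
  linarith

end ZeroMeasureCovering

section ChiralGauge

/-- A truncated chirp convolution intertwines the almost Mathieu operator with the chiral one, up
to boundary terms. -/
lemma jacobi_chirp_sum {β z h u : ℤ → ℂ} (hup : ∀ m l, β m * h l = h (l - 1) * z (m - l + 1))
    (hdown : ∀ m l, star (β (m - 1)) * h l = h (l + 1) * star (z (m - l - 1))) (E : ℂ) (L : ℕ)
    (m : ℤ) :
    jacobi (fun n => 1 + β n) (fun m => ∑ l ∈ Finset.range L, h l * u (m - l)) m -
        E * ∑ l ∈ Finset.range L, h l * u (m - l) =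
      ∑ l ∈ Finset.range L, h l * (u (m - l + 1) + u (m - l - 1) +
        (z (m - l) + star (z (m - l))) * u (m - l) - E * u (m - l)) +
      ((h (-1) * z (m + 1) * u (m + 1) - h (L - 1) * z (m - L + 1) * u (m - L + 1)) +
        (h L * star (z (m - L)) * u (m - L) - h 0 * star (z m) * u m)) := by
  induction L with
  | zero => simp [jacobi]
  | succ L ih =>
    simp only [jacobi, Finset.sum_range_succ] at ih ⊢
    have h1 := hup m L
    have h2 := hdown m L
    rw [show m + 1 - (L : ℤ) = m - L + 1 by ring, show m - 1 - (L : ℤ) = m - L - 1 by ring]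
    push_cast
    rw [show (L : ℤ) + 1 - 1 = L by ring, show m - ((L : ℤ) + 1) + 1 = m - L by ring,
      show m - ((L : ℤ) + 1) = m - L - 1 by ring]
    simp only [star_add, star_one] at ih ⊢
    linear_combination ih + u (m - L + 1) * h1 + u (m - L - 1) * h2

lemma finite_support_convolution {h u : ℤ → ℂ} (hu : u.support.Finite) (L : ℕ) :
    (fun m => ∑ l ∈ Finset.range L, h l * u (m - l)).support.Finite := by
  refine Set.Finite.subset (Set.Finite.biUnion (Finset.range L).finite_toSet
    fun l _ => hu.image fun n => n + (l : ℤ)) fun m hm => ?_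
  obtain ⟨l, hl, hne⟩ := Finset.exists_ne_zero_of_sum_ne_zero hm
  exact Set.mem_biUnion hl ⟨m - l, right_ne_zero_of_mul hne, sub_add_cancel _ _⟩

lemma tsum_norm_sq_convolution_le {h u : ℤ → ℂ} (hh : ∀ l, ‖h l‖ = 1) (hu : u.support.Finite)
    (L : ℕ) :
    ∑' m, ‖∑ l ∈ Finset.range L, h l * u (m - l)‖ ^ 2 ≤ (L : ℝ) ^ 2 * ∑' m, ‖u m‖ ^ 2 := by
  have hus := summable_norm_sq_of_finite_support hu
  have hsh : ∀ l : ℤ, Summable fun m => ‖u (m - l)‖ ^ 2 := fun l =>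
    (Equiv.subRight l).summable_iff.mpr hus
  have hle : ∀ m : ℤ, ‖∑ l ∈ Finset.range L, h l * u (m - l)‖ ^ 2 ≤
      L * ∑ l ∈ Finset.range L, ‖u (m - l)‖ ^ 2 := by
    intro m
    calc _ ≤ (∑ l ∈ Finset.range L, ‖u (m - l)‖) ^ 2 := by
          refine pow_le_pow_left₀ (norm_nonneg _) ((norm_sum_le _ _).trans_eq ?_) 2
          simp [hh]
      _ ≤ _ := by
          have := sq_sum_le_card_mul_sum_sq (s := Finset.range L) (f := fun l : ℕ => ‖u (m - l)‖)
          rwa [Finset.card_range] at this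
  calc _ ≤ ∑' m : ℤ, (L : ℝ) * ∑ l ∈ Finset.range L, ‖u (m - l)‖ ^ 2 :=
        Summable.tsum_le_tsum hle
          (summable_norm_sq_of_finite_support (finite_support_convolution hu L))
          ((summable_sum fun (l : ℕ) _ => hsh l).mul_left _)
    _ = _ := by
        rw [tsum_mul_left, Summable.tsum_finsetSum fun (l : ℕ) _ => hsh l]
        have : ∀ l : ℕ, ∑' m : ℤ, ‖u (m - l)‖ ^ 2 = ∑' m, ‖u m‖ ^ 2 := fun l =>
          (Equiv.subRight (l : ℤ)).tsum_eq fun m => ‖u m‖ ^ 2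
        simp only [this, Finset.sum_const, Finset.card_range, nsmul_eq_mul]
        ring

lemma exists_character_le_tsum_convolution {h u : ℤ → ℂ} (hh : ∀ l, ‖h l‖ = 1)
    (hu : u.support.Finite) (L : ℕ) [NeZero L] :
    ∃ a : ZMod L, L * ∑' m, ‖u m‖ ^ 2 ≤
      ∑' m, ‖∑ l ∈ Finset.range L, h l * ZMod.stdAddChar a ^ (-(l : ℤ)) * u (m - l)‖ ^ 2 := by
  have hus := summable_norm_sq_of_finite_support hu
  have hsh : ∀ l : ℤ, Summable fun m => ‖u (m - l)‖ ^ 2 := fun l =>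
    (Equiv.subRight l).summable_iff.mpr hus
  set s : Finset ℤ := (Finset.range L).map Nat.castEmbedding with hs
  have hinj : Set.InjOn (fun n : ℤ => (n : ZMod L)) s := by
    intro i hi j hj hij
    simp only [hs, Finset.coe_map, Set.mem_image, Finset.mem_coe, Finset.mem_range,
      Nat.castEmbedding_apply] at hi hj
    obtain ⟨i, hi, rfl⟩ := hi
    obtain ⟨j, hj, rfl⟩ := hj
    have h1 := (ZMod.intCast_eq_intCast_iff_dvd_sub _ _ _).mp hij
    have := Int.eq_zero_of_abs_lt_dvd h1 (by rw [abs_lt]; lia)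
    lia
  have hpars : ∀ m : ℤ, ∑ a : ZMod L,
      ‖∑ l ∈ Finset.range L, h l * ZMod.stdAddChar a ^ (-(l : ℤ)) * u (m - l)‖ ^ 2 =
      L * ∑ l ∈ Finset.range L, ‖u (m - l)‖ ^ 2 := by
    intro m
    have hf : ∀ n ∉ s, (fun n => if n ∈ s then h n * u (m - n) else 0) n = 0 :=
      fun n hn => if_neg hn
    have := sum_norm_sq_fourier hinj hf
    rw [tsum_eq_sum (s := s) fun n hn => by simp [hn]] at this
    have e : ∀ a : ZMod L, ∑' n : ℤ, (fun n => if n ∈ s then h n * u (m - n) else 0) n *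
        ZMod.stdAddChar a ^ (-n) =
        ∑ l ∈ Finset.range L, h l * ZMod.stdAddChar a ^ (-(l : ℤ)) * u (m - l) := by
      intro a
      rw [tsum_eq_sum (s := s) fun n hn => by simp [hn], hs, Finset.sum_map]
      refine Finset.sum_congr rfl fun l hl => ?_
      have : (l : ℤ) ∈ (Finset.range L).map (Nat.castEmbedding (R := ℤ)) :=
        Finset.mem_map_of_mem _ hl
      simp only [Nat.castEmbedding_apply, this, if_true]
      ring
    simp only [e] at this
    rw [this]
    congr 1
    rw [hs, Finset.sum_map]
    refine Finset.sum_congr rfl fun l hl => ?_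
    have : (l : ℤ) ∈ (Finset.range L).map (Nat.castEmbedding (R := ℤ)) :=
      Finset.mem_map_of_mem _ hl
    simp only [Nat.castEmbedding_apply, this, if_true, norm_mul, hh, one_mul]
  have hsum : ∑ _a : ZMod L, L * ∑' m, ‖u m‖ ^ 2 ≤ ∑ a : ZMod L,
      ∑' m, ‖∑ l ∈ Finset.range L, h l * ZMod.stdAddChar a ^ (-(l : ℤ)) * u (m - l)‖ ^ 2 := by
    rw [← Summable.tsum_finsetSum fun a _ => summable_norm_sq_of_finite_support
      (finite_support_convolution (h := fun l => h l * ZMod.stdAddChar a ^ (-l)) hu L)]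
    simp only [hpars]
    rw [tsum_mul_left, Summable.tsum_finsetSum fun (l : ℕ) _ => hsh l]
    have : ∀ l : ℕ, ∑' m : ℤ, ‖u (m - l)‖ ^ 2 = ∑' m, ‖u m‖ ^ 2 := fun l =>
      (Equiv.subRight (l : ℤ)).tsum_eq fun m => ‖u m‖ ^ 2
    simp [this, ZMod.card]
  obtain ⟨a, -, ha⟩ := Finset.exists_le_of_sum_le Finset.univ_nonempty hsum
  exact ⟨a, ha⟩

/-- Approximate eigenvectors of the critical almost Mathieu operator yield approximate
eigenvectors of the chiral operators. -/
theorem exists_chiral_approx {μ θ E : ℝ}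
    (happrox : ∀ δ > 0, ∃ u : ℤ → ℂ, u.support.Finite ∧ 0 < ∑' n, ‖u n‖ ^ 2 ∧
      ∑' n : ℤ, ‖u (n + 1) + u (n - 1) + ((2 * Real.cos (2 * π * μ * n + θ) : ℝ) : ℂ) * u n -
        E * u n‖ ^ 2 ≤ δ ^ 2 * ∑' n, ‖u n‖ ^ 2) {δ : ℝ} (hδ : 0 < δ) :
    ∃ ζ : ℂ, ‖ζ‖ = 1 ∧ ∃ φ : ℤ → ℂ, φ.support.Finite ∧ 0 < ∑' n, ‖φ n‖ ^ 2 ∧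
      ∑' n, ‖jacobi (chiralBond μ ζ) φ n - E * φ n‖ ^ 2 ≤ δ ^ 2 * ∑' n, ‖φ n‖ ^ 2 := by
  obtain ⟨L, hL⟩ := exists_nat_gt (34 / δ ^ 2)
  have hL0 : (0 : ℝ) < L := lt_trans (by positivity) hL
  have : NeZero L := ⟨(Nat.cast_pos.mp hL0).ne'⟩
  obtain ⟨u, hu, hu0, huE⟩ := happrox (1 / L) (by positivity)
  set ex : ℝ → ℂ := fun t => Complex.exp (Complex.I * (t : ℂ)) with hex
  have hexn : ∀ t, ‖ex t‖ = 1 := Complex.norm_exp_I_mul_ofReal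
  have hexadd : ∀ s t, ex s * ex t = ex (s + t) := fun s t => by
    simp only [hex]
    rw [← Complex.exp_add]
    congr 1
    push_cast
    ring
  have hexstar : ∀ t, star (ex t) = ex (-t) := fun t => by
    simp only [hex]
    rw [Complex.star_def, ← Complex.exp_conj]
    simp
  set h₀ : ℤ → ℂ := fun l => ex (-(π * μ * (l * (l - 1))) + θ * l) with hh₀
  obtain ⟨a, ha⟩ := exists_character_le_tsum_convolution (h := h₀) (fun l => hexn _) hu L
  set ξ : ℂ := ZMod.stdAddChar a with hξ
  have hξ0 : ξ ≠ 0 := stdAddChar_ne_zero a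
  have hξn : ‖ξ‖ = 1 := AddChar.norm_apply _ _
  have hξstar : star ξ = ξ⁻¹ := by
    rw [Complex.inv_eq_conj hξn]
    rfl
  set h : ℤ → ℂ := fun l => h₀ l * ξ ^ (-l) with hh
  set β : ℤ → ℂ := fun n => ex (2 * π * (μ * n)) * ξ with hβ
  set z : ℤ → ℂ := fun n => ex (2 * π * μ * n + θ) with hz
  have hhn : ∀ l, ‖h l‖ = 1 := fun l => by simp [hh, hh₀, hexn, hξn]
  have hzn : ∀ l, ‖z l‖ = 1 := fun l => hexn _
  have hbond : chiralBond μ ξ = fun n => 1 + β n := rfl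
  have hup : ∀ m l, β m * h l = h (l - 1) * z (m - l + 1) := by
    intro m l
    have e1 : ξ * ξ ^ (-l) = ξ ^ (-(l - 1)) := by
      rw [← zpow_one_add₀ hξ0]
      congr 1
      ring
    have e2 : ex (2 * π * (μ * m)) * h₀ l = h₀ (l - 1) * z (m - l + 1) := by
      simp only [hh₀, hz, hexadd]
      congr 1
      push_cast
      ring
    simp only [hβ, hh]
    rw [← e1]
    linear_combination ξ * ξ ^ (-l) * e2
  have hdown : ∀ m l, star (β (m - 1)) * h l = h (l + 1) * star (z (m - l - 1)) := by
    intro m l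
    have e1 : ξ⁻¹ * ξ ^ (-l) = ξ ^ (-(l + 1)) := by
      rw [← zpow_neg_one, ← zpow_add₀ hξ0]
      congr 1
      ring
    have e2 : ex (-(2 * π * (μ * (m - 1 : ℤ)))) * h₀ l = h₀ (l + 1) * star (z (m - l - 1)) := by
      simp only [hh₀, hz, hexstar, hexadd]
      congr 1
      push_cast
      ring
    simp only [hβ, hh, star_mul, hexstar, hξstar]
    rw [← e1]
    linear_combination ξ⁻¹ * ξ ^ (-l) * e2
  set v : ℤ → ℂ := fun n => u (n + 1) + u (n - 1) + (z n + star (z n)) * u n - E * u n with hv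
  have hvE : ∑' n, ‖v n‖ ^ 2 ≤ (1 / L) ^ 2 * ∑' n, ‖u n‖ ^ 2 := by
    refine le_of_eq_of_le (tsum_congr fun n => ?_) huE
    have : z n + star (z n) = ((2 * Real.cos (2 * π * μ * n + θ) : ℝ) : ℂ) := by
      rw [hexstar]
      simp only [hz, hex]
      push_cast
      rw [Complex.two_cos]
      congr 2 <;> ring
    simp only [hv, this]
  set φ : ℤ → ℂ := fun m => ∑ l ∈ Finset.range L, h l * u (m - l) with hφ
  have hφs : φ.support.Finite := finite_support_convolution hu L
  have hφle : L * ∑' m, ‖u m‖ ^ 2 ≤ ∑' m, ‖φ m‖ ^ 2 := ha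
  have hus := summable_norm_sq_of_finite_support hu
  set U : ℤ → ℝ := fun n => ‖u n‖ ^ 2 with hU
  have hvs : v.support.Finite := by
    have h1 : (fun n => u (n + 1)).support.Finite :=
      hu.preimage ((add_left_injective (1 : ℤ)).injOn)
    have h2 : (fun n => u (n - 1)).support.Finite :=
      hu.preimage ((sub_left_injective (b := (1 : ℤ))).injOn)
    refine ((h1.union h2).union hu).subset fun n hn => ?_
    by_contra hcon
    simp only [Set.mem_union, Function.mem_support, not_or, not_not] at hcon
    exact hn (by simp [hv, hcon.1.1, hcon.1.2, hcon.2])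
  set W : ℤ → ℂ := fun m => ∑ l ∈ Finset.range L, h l * v (m - l) with hW
  have hWs : W.support.Finite := finite_support_convolution hvs L
  have hWle : ∑' m, ‖W m‖ ^ 2 ≤ ∑' m, ‖u m‖ ^ 2 := by
    calc _ ≤ (L : ℝ) ^ 2 * ∑' m, ‖v m‖ ^ 2 := tsum_norm_sq_convolution_le hhn hvs L
      _ ≤ (L : ℝ) ^ 2 * ((1 / L) ^ 2 * ∑' n, ‖u n‖ ^ 2) := by gcongr
      _ = _ := by field_simp
  have hsub : ∀ c : ℤ, Summable (fun m => U (m - c)) ∧ ∑' m, U (m - c) = ∑' m, U m := fun c =>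
    ⟨(Equiv.subRight c).summable_iff.mpr hus, (Equiv.subRight c).tsum_eq U⟩
  have hpoint : ∀ m, ‖jacobi (chiralBond μ ξ) φ m - E * φ m‖ ^ 2 ≤ 2 * ‖W m‖ ^ 2 +
      (8 * U (m - (-1)) + 8 * U (m - (L - 1)) + (8 * U (m - L) + 8 * U (m - 0))) := by
    intro m
    have key := jacobi_chirp_sum (u := u) hup hdown E L m
    rw [hbond]
    refine le_of_eq_of_le (congrArg (fun x => ‖x‖ ^ 2) key) ?_
    refine (norm_sq_add_le _ _).trans (add_le_add le_rfl ?_)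
    have hb : ∀ (x y w : ℂ), ‖x‖ = 1 → ‖y‖ = 1 → ‖x * y * w‖ ^ 2 = ‖w‖ ^ 2 := by
      intro x y w hx hy
      rw [norm_mul, norm_mul, hx, hy, one_mul, one_mul]
    have hsn : ∀ n, ‖star (z n)‖ = 1 := fun n => by rw [norm_star, hzn]
    have k1 := norm_sq_add_le (h (-1) * z (m + 1) * u (m + 1) -
        h (L - 1) * z (m - L + 1) * u (m - L + 1))
        (h L * star (z (m - L)) * u (m - L) - h 0 * star (z m) * u m)
    have k2 := norm_sq_add_le (h (-1) * z (m + 1) * u (m + 1))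
      (-(h (L - 1) * z (m - L + 1) * u (m - L + 1)))
    have k3 := norm_sq_add_le (h L * star (z (m - L)) * u (m - L)) (-(h 0 * star (z m) * u m))
    rw [← sub_eq_add_neg, norm_neg, hb _ _ _ (hhn _) (hzn _), hb _ _ _ (hhn _) (hzn _)] at k2
    rw [← sub_eq_add_neg, norm_neg, hb _ _ _ (hhn _) (hsn _), hb _ _ _ (hhn _) (hsn _)] at k3
    simp only [hU, sub_neg_eq_add, sub_zero]
    rw [show m - ((L : ℤ) - 1) = m - L + 1 by ring]
    linarith
  have hs1 := (summable_norm_sq_of_finite_support hWs).mul_left 2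
  have t1 := (hsub (-1)).1.mul_left 8
  have t2 := (hsub (L - 1)).1.mul_left 8
  have t3 := (hsub L).1.mul_left 8
  have t4 := (hsub 0).1.mul_left 8
  have hJs : Summable fun m => ‖jacobi (chiralBond μ ξ) φ m - E * φ m‖ ^ 2 :=
    Summable.of_nonneg_of_le (fun m => by positivity) hpoint (hs1.add ((t1.add t2).add (t3.add t4)))
  have hfin : ∑' m, ‖jacobi (chiralBond μ ξ) φ m - E * φ m‖ ^ 2 ≤ 34 * ∑' m, U m := by
    refine (Summable.tsum_le_tsum hpoint hJs (hs1.add ((t1.add t2).add (t3.add t4)))).trans ?_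
    rw [hs1.tsum_add ((t1.add t2).add (t3.add t4)), (t1.add t2).tsum_add (t3.add t4),
      t1.tsum_add t2, t3.tsum_add t4]
    simp only [tsum_mul_left, (hsub _).2]
    linarith
  refine ⟨ξ, hξn, φ, hφs, lt_of_lt_of_le (by positivity) hφle, hfin.trans ?_⟩
  rw [div_lt_iff₀ (by positivity)] at hL
  calc 34 * ∑' m, U m ≤ (L * δ ^ 2) * ∑' m, U m := by gcongr
    _ = δ ^ 2 * (L * ∑' m, U m) := by ring
    _ ≤ _ := by gcongr

end ChiralGauge

section SelfAdjoint

variable {V : Type*} [NormedAddCommGroup V] [InnerProductSpace ℂ V] [CompleteSpace V]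

lemma notMem_spectrum_iff_bounded_below {A : V →L[ℂ] V} (hA : IsSelfAdjoint A) {t : ℝ} :
    (t : ℂ) ∉ spectrum ℂ A ↔ ∃ c > 0, ∀ x, c * ‖x‖ ≤ ‖A x - (t : ℂ) • x‖ := by
  have happly : ∀ x, (algebraMap ℂ (V →L[ℂ] V) t - A) x = -(A x - (t : ℂ) • x) := fun x => by
    simp [Algebra.algebraMap_eq_smul_one]
  rw [spectrum.notMem_iff]
  constructor
  · rintro ⟨U, hU⟩
    have hinv : ∀ x, (↑U⁻¹ : V →L[ℂ] V) ((U : V →L[ℂ] V) x) = x := fun x => by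
      rw [← mul_apply_eq_comp, U.inv_mul, one_apply_eq_self]
    have hpos : 0 < ‖(↑U⁻¹ : V →L[ℂ] V)‖ + 1 := by positivity
    refine ⟨1 / (‖(↑U⁻¹ : V →L[ℂ] V)‖ + 1), by positivity, fun x => ?_⟩
    rw [← norm_neg (A x - _), ← happly, ← hU, div_mul_eq_mul_div, one_mul, div_le_iff₀ hpos]
    have h := (↑U⁻¹ : V →L[ℂ] V).le_opNorm ((U : V →L[ℂ] V) x)
    rw [hinv] at h
    nlinarith [norm_nonneg ((U : V →L[ℂ] V) x)]
  · rintro ⟨c, hc, hle⟩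
    set T := algebraMap ℂ (V →L[ℂ] V) t - A with hT
    have hTsa : IsSelfAdjoint T := by
      refine IsSelfAdjoint.sub ?_ hA
      rw [Algebra.algebraMap_eq_smul_one]
      exact IsSelfAdjoint.smul (Complex.conj_ofReal t) (IsSelfAdjoint.one _)
    have hle' : ∀ x, c * ‖x‖ ≤ ‖T x‖ := fun x => by rw [happly, norm_neg]; exact hle x
    have hanti : AntilipschitzWith (Real.toNNReal c)⁻¹ T := by
      refine T.antilipschitz_of_bound fun x => ?_
      rw [NNReal.coe_inv, Real.coe_toNNReal c hc.le, inv_mul_eq_div, le_div_iff₀ hc, mul_comm]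
      exact hle' x
    rw [ContinuousLinearMap.isUnit_iff_bijective,
      ContinuousLinearMap.bijective_iff_dense_range_and_antilipschitz]
    refine ⟨?_, ⟨_, hanti⟩⟩
    rw [Submodule.topologicalClosure_eq_top_iff, T.orthogonal_range, hTsa.adjoint_eq]
    exact LinearMap.ker_eq_bot.mpr hanti.injective

/-- At an isolated point of its spectrum, a self-adjoint operator has a bounded generalised
inverse, and this point is an eigenvalue. -/
lemma exists_generalized_inverse {A : V →L[ℂ] V} (hA : IsSelfAdjoint A) {t : ℝ}
    (ht : (t : ℂ) ∈ spectrum ℂ A)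
    (hiso : ¬ AccPt t (Filter.principal (Complex.ofReal ⁻¹' spectrum ℂ A))) :
    ∃ G : V →L[ℂ] V, (∀ x, A (x - G (A x - (t : ℂ) • x)) =
      (t : ℂ) • (x - G (A x - (t : ℂ) • x))) ∧ ∃ u, u ≠ 0 ∧ A u = (t : ℂ) • u := by
  have hspec : Complex.ofReal ⁻¹' spectrum ℂ A = spectrum ℝ A :=
    spectrum.preimage_algebraMap ℂ
  rw [hspec] at hiso
  set g : ℝ → ℝ := fun s => (s - t)⁻¹ with hg
  have hgc : ContinuousOn g (spectrum ℝ A) := by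
    intro s _
    rcases eq_or_ne s t with rfl | hst
    · rw [AccPt, not_neBot] at hiso
      rw [← continuousWithinAt_sdiff_self, ContinuousWithinAt, Set.sdiff_eq, Set.inter_comm,
        nhdsWithin_inter', hiso]
      exact tendsto_bot
    · exact ((continuousAt_id.sub continuousAt_const).inv₀ (sub_ne_zero.mpr hst)).continuousWithinAt
  set T : V →L[ℂ] V := cfc (fun s : ℝ => s - t) A with hT
  have hTx : ∀ x, T x = A x - (t : ℂ) • x := by
    intro x
    rw [hT, cfc_sub (fun s : ℝ => s) (fun _ => t) A, cfc_id' ℝ A, cfc_const t A]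
    simp [Algebra.algebraMap_eq_smul_one]
  have hTGT : T * cfc g A * T = T := by
    rw [hT, ← cfc_mul _ _ A, ← cfc_mul _ _ A]
    congr 1
    funext s
    rcases eq_or_ne s t with rfl | hst
    · simp
    · simp only [hg]
      field_simp [sub_ne_zero.mpr hst]
  have hker : ∀ x, A (x - cfc g A (T x)) = (t : ℂ) • (x - cfc g A (T x)) := by
    intro x
    rw [← sub_eq_zero, ← hTx, map_sub, sub_eq_zero]
    exact (DFunLike.congr_fun hTGT x).symm
  refine ⟨cfc g A, fun x => by rw [← hTx]; exact hker x, ?_⟩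
  by_contra! hcon
  refine (notMem_spectrum_iff_bounded_below hA).mpr
    ⟨1 / (‖cfc g A‖ + 1), by positivity, fun x => ?_⟩ ht
  have hx : x - cfc g A (T x) = 0 := by
    by_contra hne
    exact hcon _ hne (hker x)
  have h := (cfc g A).le_opNorm (T x)
  rw [← sub_eq_zero.mp hx] at h
  rw [← hTx, div_mul_eq_mul_div, one_mul, div_le_iff₀ (by positivity)]
  nlinarith [norm_nonneg (T x)]

end SelfAdjoint

section AlmostMathieu

/-- The Hilbert space of square-summable complex sequences indexed by the integers. -/
abbrev IntHilbert : Type := lp (fun _ : ℤ => ℂ) 2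

lemma summable_norm_sq_intHilbert (u : IntHilbert) : Summable fun n => ‖u n‖ ^ 2 := by
  have := (memℓp_gen_iff (p := 2) (by norm_num)).mp (lp.memℓp u)
  simpa using this

lemma norm_sq_intHilbert (u : IntHilbert) : ‖u‖ ^ 2 = ∑' n, ‖u n‖ ^ 2 := by
  have := lp.norm_rpow_eq_tsum (p := 2) (by norm_num) u
  simpa using this

lemma norm_le_of_forall_norm_le {u v : IntHilbert} {C : ℝ} (hC : 0 ≤ C) (e : ℤ ≃ ℤ)
    (h : ∀ n, ‖u n‖ ≤ C * ‖v (e n)‖) : ‖u‖ ≤ C * ‖v‖ := by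
  refine le_of_sq_le_sq ?_ (by positivity)
  rw [mul_pow, norm_sq_intHilbert, norm_sq_intHilbert, ← e.tsum_eq fun n => ‖v n‖ ^ 2,
    ← tsum_mul_left]
  refine Summable.tsum_le_tsum (fun n => ?_) (summable_norm_sq_intHilbert u)
    ((e.summable_iff.mpr (summable_norm_sq_intHilbert v)).mul_left _)
  rw [← mul_pow]
  exact pow_le_pow_left₀ (norm_nonneg _) (h n) 2

/-- Translation of square-summable sequences. -/
noncomputable def intShift (k : ℤ) (u : IntHilbert) : IntHilbert :=
  ⟨fun n => u (n + k), memℓp_gen (by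
    have h : Summable fun n => ‖u (n + k)‖ ^ 2 :=
      (Equiv.addRight k).summable_iff.mpr (summable_norm_sq_intHilbert u)
    simpa using h)⟩

@[simp] lemma intShift_apply (k : ℤ) (u : IntHilbert) (n : ℤ) :
    intShift k u n = u (n + k) := rfl

lemma norm_intShift (k : ℤ) (u : IntHilbert) : ‖intShift k u‖ = ‖u‖ := by
  refine le_antisymm ?_ ?_
  · have := norm_le_of_forall_norm_le (u := intShift k u) (v := u) zero_le_one (Equiv.addRight k)
      (fun n => by simp)
    rwa [one_mul] at this
  · have := norm_le_of_forall_norm_le (u := u) (v := intShift k u) zero_le_one (Equiv.subRight k)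
      (fun n => by simp)
    rwa [one_mul] at this

lemma inner_intShift (k : ℤ) (u v : IntHilbert) :
    inner ℂ (intShift k u) v = inner ℂ u (intShift (-k) v) := by
  rw [lp.inner_eq_tsum, lp.inner_eq_tsum,
    ← (Equiv.addRight k).tsum_eq fun n => inner ℂ (u n) (intShift (-k) v n)]
  refine tsum_congr fun n => ?_
  simp

/-- The critical almost Mathieu operator with frequency `μ` and phase `θ`. -/
def IsAlmostMathieu (μ θ : ℝ) (H : IntHilbert →L[ℂ] IntHilbert) : Prop :=
  ∀ (u : IntHilbert) (n : ℤ),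
    H u n = u (n + 1) + u (n - 1) + ((2 * Real.cos (2 * π * μ * n + θ) : ℝ) : ℂ) * u n

variable {μ θ θ' : ℝ} {H H' : IntHilbert →L[ℂ] IntHilbert}

lemma IsAlmostMathieu.isSelfAdjoint (hH : IsAlmostMathieu μ θ H) : IsSelfAdjoint H := by
  rw [ContinuousLinearMap.isSelfAdjoint_iff_isSymmetric]
  intro u v
  set P : IntHilbert → IntHilbert := fun u => H u - intShift 1 u - intShift (-1) u with hP
  have hPn : ∀ u n, P u n = ((2 * Real.cos (2 * π * μ * n + θ) : ℝ) : ℂ) * u n := fun u n => by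
    simp only [hP, lp.coeFn_sub, Pi.sub_apply, hH u n, intShift_apply, ← sub_eq_add_neg]
    ring
  have hsplit : ∀ u, H u = intShift 1 u + intShift (-1) u + P u := fun u => by
    simp only [hP]
    abel
  have hPsymm : inner ℂ (P u) v = inner ℂ u (P v) := by
    rw [lp.inner_eq_tsum, lp.inner_eq_tsum]
    refine tsum_congr fun n => ?_
    simp only [hPn, RCLike.inner_apply, map_mul, Complex.conj_ofReal]
    ring
  simp only [ContinuousLinearMap.coe_coe]
  rw [hsplit u, hsplit v, inner_add_left, inner_add_left, inner_add_right, inner_add_right,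
    inner_intShift, inner_intShift, neg_neg, hPsymm]
  ring

/-- Translating a vector almost intertwines two almost Mathieu operators if the phases almost
match. -/
lemma IsAlmostMathieu.norm_intShift_sub_le (hH : IsAlmostMathieu μ θ H)
    (hH' : IsAlmostMathieu μ θ' H') (t : ℂ) (u : IntHilbert) (k m : ℤ) :
    ‖H (intShift k u) - t • intShift k u‖ ≤
      ‖H' u - t • u‖ + 2 * |2 * π * μ * k + 2 * π * m - (θ - θ')| * ‖u‖ := by
  set ε := |2 * π * μ * k + 2 * π * m - (θ - θ')| with hε
  have hcos : ∀ n : ℤ, |2 * Real.cos (2 * π * μ * n + θ) -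
      2 * Real.cos (2 * π * μ * (n + k : ℤ) + θ')| ≤ 2 * ε := by
    intro n
    have h := Real.abs_cos_sub_cos_le (2 * π * μ * n + θ)
      (2 * π * μ * (n + k : ℤ) + θ' + m * (2 * π))
    rw [Real.cos_add_int_mul_two_pi] at h
    rw [← mul_sub, abs_mul, abs_two]
    refine mul_le_mul_of_nonneg_left (h.trans_eq ?_) zero_le_two
    rw [hε, abs_sub_comm]
    congr 1
    push_cast
    ring
  have hdiff : ‖(H (intShift k u) - t • intShift k u) - intShift k (H' u - t • u)‖ ≤
      2 * ε * ‖u‖ := by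
    refine norm_le_of_forall_norm_le (by positivity) (Equiv.addRight k) fun n => ?_
    have : ((H (intShift k u) - t • intShift k u) - intShift k (H' u - t • u) : IntHilbert) n =
        ((2 * Real.cos (2 * π * μ * n + θ) -
          2 * Real.cos (2 * π * μ * (n + k : ℤ) + θ') : ℝ) : ℂ) * u (n + k) := by
      simp only [lp.coeFn_sub, Pi.sub_apply, lp.coeFn_smul, Pi.smul_apply, smul_eq_mul, hH _ n,
        intShift_apply, hH' _ (n + k)]
      rw [show n + 1 + k = n + k + 1 by ring, show n - 1 + k = n + k - 1 by ring]
      push_cast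
      ring
    rw [this, norm_mul, Complex.norm_real, Real.norm_eq_abs]
    exact mul_le_mul_of_nonneg_right (hcos n) (norm_nonneg _)
  have h := norm_add_le ((H (intShift k u) - t • intShift k u) - intShift k (H' u - t • u))
    (intShift k (H' u - t • u))
  rw [sub_add_cancel, norm_intShift] at h
  linarith

lemma Irrational.exists_int_abs_lt (hμ : Irrational μ) (α : ℝ) {ε : ℝ} (hε : 0 < ε) :
    ∃ k m : ℤ, |2 * π * μ * k + 2 * π * m - α| < ε := by
  have hd : Dense (AddSubgroup.closure {2 * π * μ, 2 * π} : Set ℝ) := by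
    rw [dense_addSubgroupClosure_pair_iff, mul_div_cancel_left₀ _ (by positivity)]
    exact hμ
  obtain ⟨y, hy, hyα⟩ := Metric.dense_iff.mp hd α ε hε
  obtain ⟨k, m, rfl⟩ := AddSubgroup.mem_closure_pair.mp hyα
  refine ⟨k, m, ?_⟩
  rw [Metric.mem_ball, Real.dist_eq] at hy
  convert hy using 2
  simp only [zsmul_eq_mul]
  ring

lemma IsAlmostMathieu.spectrum_subset (hμ : Irrational μ) (hH : IsAlmostMathieu μ θ H)
    (hH' : IsAlmostMathieu μ θ' H') : spectrum ℂ H' ⊆ spectrum ℂ H := by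
  intro z hz
  obtain ⟨x, rfl⟩ : ∃ x : ℝ, (x : ℂ) = z :=
    ⟨z.re, (hH'.isSelfAdjoint.mem_spectrum_eq_re hz).symm⟩
  by_contra hcon
  obtain ⟨c, hc, hle⟩ := (notMem_spectrum_iff_bounded_below hH.isSelfAdjoint).mp hcon
  refine (notMem_spectrum_iff_bounded_below hH'.isSelfAdjoint).mpr ⟨c / 2, by positivity,
    fun u => ?_⟩ hz
  obtain ⟨k, m, hkm⟩ := hμ.exists_int_abs_lt (θ - θ') (ε := c / 4) (by positivity)
  have h1 := hle (intShift k u)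
  have h2 := hH.norm_intShift_sub_le hH' (x : ℂ) u k m
  rw [norm_intShift] at h1
  nlinarith [norm_nonneg u]

/-- Points of the spectrum have finitely supported approximate eigenvectors. -/
lemma IsAlmostMathieu.exists_finite_support_approx (hH : IsAlmostMathieu μ θ H) {E : ℝ}
    (hE : (E : ℂ) ∈ spectrum ℂ H) {δ : ℝ} (hδ : 0 < δ) :
    ∃ u : ℤ → ℂ, u.support.Finite ∧ 0 < ∑' n, ‖u n‖ ^ 2 ∧
      ∑' n : ℤ, ‖u (n + 1) + u (n - 1) + ((2 * Real.cos (2 * π * μ * n + θ) : ℝ) : ℂ) * u n -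
        E * u n‖ ^ 2 ≤ δ ^ 2 * ∑' n, ‖u n‖ ^ 2 := by
  have hnb : ¬ ∀ x, δ * ‖x‖ ≤ ‖H x - (E : ℂ) • x‖ := fun h =>
    (notMem_spectrum_iff_bounded_below hH.isSelfAdjoint).mpr ⟨δ, hδ, h⟩ hE
  push Not at hnb
  obtain ⟨x, hx⟩ := hnb
  have hopen : IsOpen {x : IntHilbert | ‖H x - (E : ℂ) • x‖ < δ * ‖x‖} :=
    isOpen_lt (by fun_prop) (by fun_prop)
  obtain ⟨s, hs⟩ := ((lp.hasSum_single (p := 2) (by norm_num) x).eventually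
    (hopen.eventually_mem hx)).exists
  set y : IntHilbert := ∑ i ∈ s, lp.single 2 i (x i) with hy
  have hys : ∀ n ∉ s, y n = 0 := by
    intro n hn
    rw [hy, lp.coeFn_sum, Finset.sum_apply]
    refine Finset.sum_eq_zero fun i hi => ?_
    rw [lp.single_apply_ne]
    rintro rfl
    exact hn hi
  have hyn : 0 < ‖y‖ := by
    have : 0 < δ * ‖y‖ := (norm_nonneg _).trans_lt hs
    exact pos_of_mul_pos_right this hδ.le
  refine ⟨y, s.finite_toSet.subset fun n hn => by_contra fun h => hn (hys n h), ?_, ?_⟩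
  · rw [← norm_sq_intHilbert]
    positivity
  · rw [← norm_sq_intHilbert, ← mul_pow]
    refine le_of_eq_of_le ?_ (pow_le_pow_left₀ (norm_nonneg _) hs.le 2)
    rw [norm_sq_intHilbert]
    refine tsum_congr fun n => ?_
    simp only [lp.coeFn_sub, Pi.sub_apply, lp.coeFn_smul, Pi.smul_apply, smul_eq_mul, hH y n]

/-- Square-summable eigenvectors for a given eigenvalue are proportional. -/
lemma IsAlmostMathieu.exists_eq_smul (hH : IsAlmostMathieu μ θ H) {E : ℂ} {u w : IntHilbert}
    (hu : H u = E • u) (hw : H w = E • w) {N : ℤ} (hN : u N ≠ 0) : ∃ c : ℂ, w = c • u := by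
  have hrec : ∀ x : IntHilbert, H x = E • x → ∀ n, x (n + 1) + x (n - 1) =
      (E - ((2 * Real.cos (2 * π * μ * n + θ) : ℝ) : ℂ)) * x n := by
    intro x hx n
    have h := hH x n
    rw [hx, lp.coeFn_smul, Pi.smul_apply, smul_eq_mul] at h
    linear_combination -h
  set W : ℤ → ℂ := fun n => u (n + 1) * w n - u n * w (n + 1) with hW
  have hstep : ∀ n, W n = W (n - 1) := by
    intro n
    have h1 := hrec u hu n
    have h2 := hrec w hw n
    simp only [hW, sub_add_cancel]
    linear_combination w n * h1 - u n * h2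
  have hconst : ∀ n, W n = W 0 := by
    intro n
    induction n using Int.induction_on with
    | zero => rfl
    | succ n ih => rw [hstep, add_sub_cancel_right, ih]
    | pred n ih => rw [← hstep, ih]
  have hdecay : ∀ x : IntHilbert, Tendsto (fun n : ℕ => x n) atTop (nhds 0) := by
    intro x
    have h := (summable_norm_sq_intHilbert x).tendsto_cofinite_zero
    have h1 : Tendsto (fun n : ℤ => ‖x n‖) cofinite (nhds 0) := by
      have := h.sqrt
      simpa using this
    have h2 := tendsto_zero_iff_norm_tendsto_zero.mpr h1
    have h3 : Tendsto (fun n : ℕ => (n : ℤ)) atTop cofinite := by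
      rw [← Nat.cofinite_eq_atTop]
      exact Nat.cast_injective.tendsto_cofinite
    exact h2.comp h3
  have hzero : ∀ n, W n = 0 := by
    intro n
    rw [hconst]
    have hs : ∀ x : IntHilbert, Tendsto (fun n : ℕ => x ((n : ℤ) + 1)) atTop (nhds 0) := fun x =>
      hdecay (intShift 1 x)
    have h := ((hs u).mul (hdecay w)).sub ((hdecay u).mul (hs w))
    rw [mul_zero, sub_zero] at h
    have hW' : Tendsto (fun n : ℕ => W n) atTop (nhds (W 0)) :=
      tendsto_const_nhds.congr fun n => (hconst n).symm
    exact tendsto_nhds_unique hW' h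
  set d : IntHilbert := w - (w N / u N) • u with hd
  have hdn : ∀ n, d n = w n - w N / u N * u n := fun n => by
    simp only [hd, lp.coeFn_sub, Pi.sub_apply, lp.coeFn_smul, Pi.smul_apply, smul_eq_mul]
  have hdE : H d = E • d := by
    rw [hd, map_sub, map_smul, hu, hw, smul_sub, smul_comm]
  have hd0 : d N = 0 := by
    rw [hdn, div_mul_cancel₀ _ hN, sub_self]
  have hd1 : d (N + 1) = 0 := by
    rw [hdn]
    have := hzero N
    simp only [hW] at this
    field_simp
    linear_combination -this
  have hpair : ∀ k : ℤ, d (N + k) = 0 ∧ d (N + k + 1) = 0 := by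
    intro k
    induction k using Int.induction_on with
    | zero => simpa using ⟨hd0, hd1⟩
    | succ k ih =>
      refine ⟨by rw [← add_assoc]; exact ih.2, ?_⟩
      have h := hrec d hdE (N + k + 1)
      rw [ih.2, add_sub_cancel_right, ih.1, mul_zero, add_zero] at h
      rw [← add_assoc]
      exact h
    | pred k ih =>
      have e : N + (-(k : ℤ) - 1) = N + -(k : ℤ) - 1 := by ring
      rw [e, sub_add_cancel]
      have h := hrec d hdE (N + -(k : ℤ))
      rw [ih.1, ih.2, mul_zero, zero_add] at h
      exact ⟨h, ih.1⟩
  refine ⟨w N / u N, sub_eq_zero.mp (lp.ext (funext fun n => ?_))⟩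
  have := (hpair (n - N)).1
  rwa [add_sub_cancel] at this

/-- The spectrum has no isolated points. -/
lemma IsAlmostMathieu.accPt (hμ : Irrational μ) (hH : IsAlmostMathieu μ θ H) {t : ℝ}
    (ht : (t : ℂ) ∈ spectrum ℂ H) :
    AccPt t (Filter.principal (Complex.ofReal ⁻¹' spectrum ℂ H)) := by
  by_contra hiso
  obtain ⟨G, hG, u, hu0, hu⟩ := exists_generalized_inverse hH.isSelfAdjoint ht hiso
  have hun : 0 < ‖u‖ := norm_pos_iff.mpr hu0
  obtain ⟨N, hN⟩ : ∃ N, u N ≠ 0 := by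
    by_contra! h
    exact hu0 (lp.ext (funext h))
  have hNpos : 0 < ‖u N‖ := norm_pos_iff.mpr hN
  set g := ‖G‖ with hg
  set ε : ℝ := ‖u N‖ / 4 with hε
  have hε0 : 0 < ε := by positivity
  have hNle : ‖u N‖ ≤ ‖u‖ := lp.norm_apply_le_norm (by norm_num) u N
  have hfin : {n : ℤ | ε < ‖u n‖}.Finite := by
    have h := (summable_norm_sq_intHilbert u).tendsto_cofinite_zero.eventually
      (gt_mem_nhds (show (0 : ℝ) < ε ^ 2 by positivity))
    rw [eventually_cofinite] at h
    refine h.subset fun n hn => ?_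
    simp only [Set.mem_ofPred_eq, not_lt] at hn ⊢
    exact pow_le_pow_left₀ hε0.le hn.le 2
  obtain ⟨B, hB⟩ : ∃ B : ℕ, ∀ n : ℤ, ε < ‖u n‖ → n ≤ B := by
    obtain ⟨b, hb⟩ := hfin.bddAbove
    exact ⟨b.toNat, fun n hn => (hb hn).trans (Int.self_le_toNat b)⟩
  obtain ⟨n₀, hn₀⟩ := hμ.exists_forall_lt_den (B + N.natAbs)
  obtain ⟨n₁, hn₁⟩ := exists_nat_gt (4 * π * g * ‖u‖ / ε)
  obtain ⟨r, hr, -⟩ := Real.exists_rat_abs_sub_le_and_den_le μ (n := max n₀ n₁ + 1) (by lia)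
  have hrden := hn₀ (max n₀ n₁ + 1) (by lia) r hr
  have hd0 : (0 : ℝ) < r.den := Nat.cast_pos.mpr r.den_pos
  have hsmall : |2 * π * μ * (r.den : ℤ) + 2 * π * (-r.num : ℤ) - (θ - θ)| ≤ 2 * π / (n₁ + 1) := by
    have hrM : (r : ℝ) * r.den = r.num := by exact_mod_cast Rat.mul_den_eq_num r
    have : 2 * π * μ * (r.den : ℤ) + 2 * π * (-r.num : ℤ) - (θ - θ) =
        2 * π * (r.den * (μ - r)) := by
      push_cast
      linear_combination 2 * π * hrM
    rw [this, abs_mul, abs_of_pos (by positivity : (0 : ℝ) < 2 * π), abs_mul, abs_of_pos hd0]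
    have hn : (n₁ : ℝ) + 1 ≤ ((max n₀ n₁ + 1 : ℕ) : ℝ) + 1 := by
      have : n₁ ≤ max n₀ n₁ + 1 := by lia
      exact add_le_add_left (Nat.cast_le.mpr this) 1
    calc 2 * π * (r.den * |μ - r|)
        ≤ 2 * π * (r.den * (1 / ((((max n₀ n₁ + 1 : ℕ) : ℝ) + 1) * r.den))) := by gcongr
      _ ≤ 2 * π * (r.den * (1 / (((n₁ : ℝ) + 1) * r.den))) := by gcongr
      _ = _ := by field_simp
  set v := intShift (r.den : ℤ) u with hv
  have hTv : ‖H v - (t : ℂ) • v‖ ≤ 4 * π / (n₁ + 1) * ‖u‖ := by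
    have h := hH.norm_intShift_sub_le hH (t : ℂ) u r.den (-r.num)
    rw [hu, sub_self, norm_zero, zero_add] at h
    refine h.trans ?_
    calc _ ≤ 2 * (2 * π / (n₁ + 1)) * ‖u‖ := by gcongr
      _ = _ := by ring
  set y := G (H v - (t : ℂ) • v) with hy
  have hyn : ‖y‖ ≤ ε := by
    calc ‖y‖ ≤ g * ‖H v - (t : ℂ) • v‖ := G.le_opNorm _
      _ ≤ g * (4 * π / (n₁ + 1) * ‖u‖) := by gcongr
      _ = 4 * π * g * ‖u‖ / (n₁ + 1) := by ring
      _ ≤ ε := by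
        rw [div_lt_iff₀ hε0] at hn₁
        rw [div_le_iff₀ (by positivity)]
        nlinarith
  obtain ⟨c, hc⟩ := hH.exists_eq_smul hu (hG v) hN
  have hvN : ‖v N‖ ≤ ε := by
    by_contra! h
    have := hB _ h
    lia
  have hcN : ‖c‖ * ‖u N‖ ≤ 2 * ε := by
    have h := congrArg (fun x : IntHilbert => x N) hc
    simp only [lp.coeFn_sub, Pi.sub_apply, lp.coeFn_smul, Pi.smul_apply, smul_eq_mul] at h
    rw [← norm_mul, ← h]
    refine (norm_sub_le _ _).trans ?_
    have := lp.norm_apply_le_norm (by norm_num) y N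
    linarith
  have hcu : ‖u‖ ≤ ‖c‖ * ‖u‖ + ε := by
    have h : v = c • u + y := by
      rw [← hc, sub_add_cancel]
    calc ‖u‖ = ‖v‖ := (norm_intShift _ u).symm
      _ ≤ ‖c • u‖ + ‖y‖ := by rw [h]; exact norm_add_le _ _
      _ ≤ _ := by rw [norm_smul]; gcongr
  have hc2 : ‖c‖ ≤ 1 / 2 := by
    by_contra! h
    have : 1 / 2 * ‖u N‖ < ‖c‖ * ‖u N‖ := mul_lt_mul_of_pos_right h hNpos
    rw [hε] at hcN
    linarith
  have : ‖c‖ * ‖u‖ ≤ 1 / 2 * ‖u‖ := mul_le_mul_of_nonneg_right hc2 hun.le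
  rw [hε] at hcu
  linarith

end AlmostMathieu

/-- For irrational `μ`, the spectrum of the critical almost Mathieu
operator `H_{μ,θ}` is independent of `θ`, is contained in the reals, and viewed as a
subset of `ℝ` it is a nonempty compact set with no isolated points, empty interior,
and Lebesgue measure zero (a Cantor set of zero measure). -/
theorem critical_almost_mathieu_ten_martini
    (μ : ℝ) (hμ : Irrational μ) (θ θ' : ℝ)
    (H H' : lp (fun _ : ℤ => ℂ) 2 →L[ℂ] lp (fun _ : ℤ => ℂ) 2)
    (hH : ∀ (u : lp (fun _ : ℤ => ℂ) 2) (n : ℤ),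
      H u n = u (n + 1) + u (n - 1) + ((2 * Real.cos (2 * π * μ * n + θ) : ℝ) : ℂ) * u n)
    (hH' : ∀ (u : lp (fun _ : ℤ => ℂ) 2) (n : ℤ),
      H' u n = u (n + 1) + u (n - 1) + ((2 * Real.cos (2 * π * μ * n + θ') : ℝ) : ℂ) * u n) :
    spectrum ℂ H = spectrum ℂ H' ∧
    spectrum ℂ H ⊆ Set.range (Complex.ofReal) ∧
    (Complex.ofReal ⁻¹' spectrum ℂ H).Nonempty ∧
    IsCompact (Complex.ofReal ⁻¹' spectrum ℂ H) ∧
    (∀ x ∈ Complex.ofReal ⁻¹' spectrum ℂ H,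
      AccPt x (Filter.principal (Complex.ofReal ⁻¹' spectrum ℂ H))) ∧
    interior (Complex.ofReal ⁻¹' spectrum ℂ H) = ∅ ∧
    volume (Complex.ofReal ⁻¹' spectrum ℂ H) = 0 := by
  have hA : IsAlmostMathieu μ θ H := hH
  have hA' : IsAlmostMathieu μ θ' H' := hH'
  have hreal : spectrum ℂ H ⊆ Set.range (Complex.ofReal) := fun z hz =>
    ⟨z.re, (hA.isSelfAdjoint.mem_spectrum_eq_re hz).symm⟩
  have hvol : volume (Complex.ofReal ⁻¹' spectrum ℂ H) = 0 :=
    volume_eq_zero_of_chiral_approx hμ fun E hE δ hδ =>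
      exists_chiral_approx (fun δ hδ => hA.exists_finite_support_approx hE hδ) hδ
  have hspec : Complex.ofReal ⁻¹' spectrum ℂ H = spectrum ℝ H := spectrum.preimage_algebraMap ℂ
  have : Nontrivial (lp (fun _ : ℤ => ℂ) 2) := by
    refine ⟨lp.single 2 0 1, 0, fun h => ?_⟩
    have h0 := congrArg (fun x : lp (fun _ : ℤ => ℂ) 2 => x 0) h
    simp at h0
  refine ⟨Set.Subset.antisymm (hA'.spectrum_subset hμ hA) (hA.spectrum_subset hμ hA'), hreal, ?_,
    ?_, fun x hx => hA.accPt hμ hx, ?_, hvol⟩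
  · obtain ⟨z, hz⟩ := spectrum.nonempty H
    obtain ⟨x, rfl⟩ := hreal hz
    exact ⟨x, hz⟩
  · rw [hspec]
    exact spectrum.isCompact H
  · by_contra hne
    have hpos := isOpen_interior.measure_pos volume (Set.nonempty_iff_ne_empty.mpr hne)
    exact hpos.ne' (measure_mono_null interior_subset hvol)
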